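/- For every blind MDP Γ and initial belief p₁ ∈ Δ(K), there exists a (deterministic) belief p* ∈ Δ(K) such that: (1) for all ε > 0 there exist a strategy σ^ε and m₀ ≥ 1 such that under σ^ε the (deterministic) belief at stage m₀ satisfies ‖p_{m₀} − p*‖₁ ≤ ε; and (2) there exists a strategy σ ∈ A^ℕ such that for all k ∈ Supp(p*), (1/n) Σ_{m=1}^n g_m → γ^k_∞(σ) P^k_σ-almost surely, and γ^{p*}_∞(σ) = v_∞(p*) = v_∞(p₁). -/

import Mathlib

open MeasureTheory Filter

namespace PomdpPaper

/-- A belief (probability vector) on `Fin n`. -/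
def IsBelief {n : ℕ} (p : Fin n → ℝ) : Prop :=
  (∀ k, 0 ≤ p k) ∧ ∑ k, p k = 1

/-- The measure on a finite type associated with a probability vector. -/
noncomputable def vecMeasure {α : Type*} [Fintype α] [MeasurableSpace α] (p : α → ℝ) :
    Measure α :=
  ∑ x : α, ENNReal.ofReal (p x) • Measure.dirac x

/-- The Dirac belief at a point. -/
def diracBelief {n : ℕ} (k : Fin n) : Fin n → ℝ := fun k' => if k' = k then 1 else 0

/-- The `i`-th binary digit of a real number `x ∈ [0,1)` (as a real number `0` or `1`). -/
noncomputable def digitR (x : ℝ) (i : ℕ) : ℝ :=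
  if ⌊x * 2 ^ (i + 1)⌋ % 2 = 1 then 1 else 0

/-- From one uniform seed `x ∈ [0,1)`, a sequence `unif x 0, unif x 1, …` of
(independent, uniformly distributed on `[0,1]`) real numbers, obtained by splitting the
binary digits of `x` along the pairing function. -/
noncomputable def unif (x : ℝ) (m : ℕ) : ℝ :=
  ∑' j : ℕ, digitR x (Nat.pair m j) / 2 ^ (j + 1)

open Classical in
/-- Inverse-transform sampling from a probability vector on `Fin n` using a seed `u ∈ [0,1]`. -/
noncomputable def sampleFin {n : ℕ} (hn : 0 < n) (p : Fin n → ℝ) (u : ℝ) : Fin n :=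
  let s : Finset (Fin n) :=
    Finset.univ.filter fun y : Fin n => u < ∑ z ∈ Finset.univ.filter fun z : Fin n => z ≤ y, p z
  if hs : s.Nonempty then s.min' hs else ⟨0, hn⟩

/-- Inverse-transform sampling from a probability vector on a finite nonempty type. -/
noncomputable def sampleOn {β : Type*} [Fintype β] [Nonempty β] (p : β → ℝ) (u : ℝ) : β :=
  (Fintype.equivFin β).symm
    (sampleFin Fintype.card_pos (fun i => p ((Fintype.equivFin β).symm i)) u)

/-- A POMDP with states `Fin nK`, actions `Fin nA`, signals `Fin nS`, transition function `q`
and reward function `g` with values in `[0,1]`. -/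
structure POMDP where
  nK : ℕ
  nA : ℕ
  nS : ℕ
  hK : 0 < nK
  hA : 0 < nA
  hS : 0 < nS
  q : Fin nK → Fin nA → Fin nK × Fin nS → ℝ
  q_nonneg : ∀ k a y, 0 ≤ q k a y
  q_sum : ∀ k a, ∑ y, q k a y = 1
  g : Fin nK → Fin nA → ℝ
  g_nonneg : ∀ k a, 0 ≤ g k a
  g_le_one : ∀ k a, g k a ≤ 1

namespace POMDP

variable (Γ : POMDP)

/-- The state space. -/
abbrev K := Fin Γ.nK
/-- The action space. -/
abbrev A := Fin Γ.nA
/-- The signal space. -/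
abbrev S := Fin Γ.nS

instance : Nonempty Γ.K := ⟨⟨0, Γ.hK⟩⟩
instance : Nonempty Γ.A := ⟨⟨0, Γ.hA⟩⟩
instance : Nonempty Γ.S := ⟨⟨0, Γ.hS⟩⟩

/-- A history: the finite sequence of past actions and signals. -/
abbrev Hist := List (Γ.A × Γ.S)

/-- A (pure) strategy: a map from histories to actions. -/
abbrev Strategy := Γ.Hist → Γ.A

/-- The sample space carrying all the randomness: an initial state together with a
uniform seed in `[0,1)` used to draw all the transitions. -/
abbrev Env := Γ.K × ℝ

/-- The probability measure on the sample space induced by the initial belief `p1`: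
the initial state is drawn according to `p1`, the seed uniformly on `[0,1)`. -/
noncomputable def envMeasure (p1 : Γ.K → ℝ) : Measure Γ.Env :=
  (vecMeasure p1).prod (volume.restrict (Set.Ico (0 : ℝ) 1))

/-- The trajectory: `(Γ.traj σ ω m).1` is the state `k_{m+1}` at stage `m+1` and
`(Γ.traj σ ω m).2` is the history before stage `m+1` (of length `m`), when the
decision-maker uses strategy `σ` and the randomness is `ω`.  At each stage, the pair
(new state, signal) is drawn from `q` via inverse-transform sampling from a fresh
uniform variable. -/
noncomputable def traj (σ : Γ.Strategy) (ω : Γ.Env) : ℕ → Γ.K × Γ.Hist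
  | 0 => (ω.1, [])
  | m + 1 =>
    let p := traj σ ω m
    let a := σ p.2
    let y := sampleOn (Γ.q p.1 a) (unif ω.2 m)
    (y.1, p.2 ++ [(a, y.2)])

/-- The state `k_{m+1}` at stage `m+1` (`m` is 0-indexed). -/
noncomputable def state (σ : Γ.Strategy) (ω : Γ.Env) (m : ℕ) : Γ.K := (Γ.traj σ ω m).1

/-- The history before stage `m+1` (a list of length `m`). -/
noncomputable def hist (σ : Γ.Strategy) (ω : Γ.Env) (m : ℕ) : Γ.Hist := (Γ.traj σ ω m).2

/-- The action `a_{m+1}` played at stage `m+1`. -/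
noncomputable def act (σ : Γ.Strategy) (ω : Γ.Env) (m : ℕ) : Γ.A := σ (Γ.hist σ ω m)

/-- The reward `g_{m+1}` obtained at stage `m+1`. -/
noncomputable def rew (σ : Γ.Strategy) (ω : Γ.Env) (m : ℕ) : ℝ :=
  Γ.g (Γ.state σ ω m) (Γ.act σ ω m)

/-- The average reward over the first `n` stages. -/
noncomputable def avg (σ : Γ.Strategy) (ω : Γ.Env) (n : ℕ) : ℝ :=
  (1 / n : ℝ) * ∑ m ∈ Finset.range n, Γ.rew σ ω m

/-- The probability of an event under initial belief `p1` (the strategy `σ` is recorded for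
readability; the underlying measure does not depend on it). -/
noncomputable def prob (p1 : Γ.K → ℝ) (_σ : Γ.Strategy) (E : Set Γ.Env) : ℝ :=
  (Γ.envMeasure p1 E).toReal

/-- The long-run average payoff `γ^{p1}_∞(σ) = E[liminf (1/n) ∑ g_m]`. -/
noncomputable def pay (p1 : Γ.K → ℝ) (σ : Γ.Strategy) : ℝ :=
  ∫ ω, atTop.liminf (Γ.avg σ ω) ∂(Γ.envMeasure p1)

/-- The payoff starting from a deterministic state `k`, i.e. `γ^k_∞(σ)`. -/
noncomputable def payK (k : Γ.K) (σ : Γ.Strategy) : ℝ := Γ.pay (diracBelief k) σ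

/-- The value `v_∞(p1)`. -/
noncomputable def val (p1 : Γ.K → ℝ) : ℝ := ⨆ σ : Γ.Strategy, Γ.pay p1 σ

/-- A strategy has finite memory if it is implemented by a finite-state transducer. -/
def FiniteMemory (σ : Γ.Strategy) : Prop :=
  ∃ (n : ℕ) (m0 : Fin n) (σa : Fin n → Γ.A) (σu : Fin n → Γ.A × Γ.S → Fin n),
    ∀ h : Γ.Hist, σ h = σa (h.foldl σu m0)

/-- A blind MDP: the signal set is a singleton. -/
def Blind : Prop := Γ.nS = 1

/-- The strategy induced by a sequence of actions `a_1, a_2, …` (`as m` is the action played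
at stage `m+1`, regardless of the observed history). -/
def blindStrat (as : ℕ → Γ.A) : Γ.Strategy := fun h => as h.length

end POMDP

/-- A sequence is eventually periodic if it is periodic with some period `T ≥ 1` from
some stage `N` on. -/
def EventuallyPeriodic {α : Type*} (as : ℕ → α) : Prop :=
  ∃ T ≥ 1, ∃ N ≥ 1, ∀ m ≥ N, as (m + T) = as m


namespace POMDP

variable (Γ : POMDP)

/-- In a blind MDP the belief process is deterministic: the belief at stage `m + 1` is the
law of the state `k_{m+1}`. -/
noncomputable def blindBelief (p1 : Γ.K → ℝ) (σ : Γ.Strategy) (m : ℕ) : Γ.K → ℝ :=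
  fun k => Γ.prob p1 σ {ω | Γ.state σ ω m = k}

end POMDP

section Aux
open ProbabilityTheory

section Part1
lemma liminf_le_add_of {u v : ℕ → ℝ} {ε : ℝ} (C : ℝ) (hu : ∀ n, |u n| ≤ C) (hv : ∀ n, |v n| ≤ C)
    (h : ∀ᶠ n in atTop, u n ≤ v n + ε) : atTop.liminf u ≤ atTop.liminf v + ε := by
  have bu : IsBoundedUnder (· ≥ ·) atTop u := isBoundedUnder_of ⟨-C, fun n => (abs_le.1 (hu n)).1⟩
  have cv : IsCoboundedUnder (· ≥ ·) atTop v :=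
    (isBoundedUnder_of ⟨C, fun n => (abs_le.1 (hv n)).2⟩ :
      IsBoundedUnder (· ≤ ·) atTop v).isCoboundedUnder_ge
  rw [← sub_le_iff_le_add]
  apply le_of_forall_lt
  intro c hc
  obtain ⟨d, hd1, hd2⟩ := exists_between hc
  refine hd1.trans_le (le_liminf_of_le cv ?_)
  have := eventually_lt_of_lt_liminf (u := u) (b := d + ε) (by linarith) bu
  filter_upwards [h, this] with n h1 h2
  linarith

lemma liminf_eq_of_tendsto {u v : ℕ → ℝ} (C : ℝ) (hu : ∀ n, |u n| ≤ C) (hv : ∀ n, |v n| ≤ C)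
    (h : Tendsto (fun n => u n - v n) atTop (nhds 0)) : atTop.liminf u = atTop.liminf v := by
  apply le_antisymm
  · apply le_of_forall_pos_le_add
    intro ε hε
    apply liminf_le_add_of C hu hv
    filter_upwards [h.eventually (gt_mem_nhds hε)] with n hn
    linarith
  · apply le_of_forall_pos_le_add
    intro ε hε
    apply liminf_le_add_of C hv hu
    filter_upwards [h.eventually (lt_mem_nhds (neg_lt_zero.2 hε))] with n hn
    linarith

lemma liminf_abs_le {u : ℕ → ℝ} (C : ℝ) (hu : ∀ n, |u n| ≤ C) : |atTop.liminf u| ≤ C := by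
  have bu : IsBoundedUnder (· ≥ ·) atTop u := isBoundedUnder_of ⟨-C, fun n => (abs_le.1 (hu n)).1⟩
  have cu : IsCoboundedUnder (· ≥ ·) atTop u :=
    (isBoundedUnder_of ⟨C, fun n => (abs_le.1 (hu n)).2⟩ :
      IsBoundedUnder (· ≤ ·) atTop u).isCoboundedUnder_ge
  rw [abs_le]
  refine ⟨le_liminf_of_le cu (Eventually.of_forall fun n => (abs_le.1 (hu n)).1), ?_⟩
  exact liminf_le_of_frequently_le (Frequently.of_forall fun n => (abs_le.1 (hu n)).2) bu

section Birk
variable {Ω : Type*} [MeasurableSpace Ω]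

noncomputable def bavg (T : Ω → Ω) (f : Ω → ℝ) (ω : Ω) (n : ℕ) : ℝ :=
  (1 / n : ℝ) * ∑ m ∈ Finset.range n, f (T^[m] ω)

noncomputable def maxW (T : Ω → Ω) (φ : Ω → ℝ) : ℕ → Ω → ℝ
  | 0 => fun _ => 0
  | N + 1 => fun ω => max 0 (φ ω + maxW T φ N (T ω))

lemma abs_avg_le (C : ℝ) (hC : 0 ≤ C) (s : ℕ → ℝ) (hs : ∀ m, |s m| ≤ C) (n : ℕ) :
    |(1 / n : ℝ) * ∑ m ∈ Finset.range n, s m| ≤ C := by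
  rcases Nat.eq_zero_or_pos n with rfl | hn
  · simpa using hC
  · have hn' : (0:ℝ) < n := by exact_mod_cast hn
    rw [abs_mul, abs_of_nonneg (by positivity), one_div, inv_mul_le_iff₀ hn']
    refine (Finset.abs_sum_le_sum_abs _ _).trans ?_
    refine (Finset.sum_le_sum fun m _ => hs m).trans ?_
    simp

lemma tendsto_avg_shift (C : ℝ) (s : ℕ → ℝ) (hs : ∀ m, |s m| ≤ C) :
    Tendsto (fun n : ℕ => (1 / n : ℝ) * ∑ m ∈ Finset.range n, s (m + 1)
      - (1 / n : ℝ) * ∑ m ∈ Finset.range n, s m) atTop (nhds 0) := by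
  have : ∀ n : ℕ, (1 / n : ℝ) * ∑ m ∈ Finset.range n, s (m + 1)
      - (1 / n : ℝ) * ∑ m ∈ Finset.range n, s m = (1 / n : ℝ) * (s n - s 0) := by
    intro n
    rw [← mul_sub, ← Finset.sum_sub_distrib, Finset.sum_range_sub]
  simp_rw [this]
  apply squeeze_zero_norm (a := fun n : ℕ => (2 * C) * (1 / n : ℝ))
  · intro n
    rw [Real.norm_eq_abs, abs_mul, abs_of_nonneg (by positivity : (0:ℝ) ≤ 1 / n), mul_comm]
    gcongr
    have := abs_sub (s n) (s 0)
    linarith [hs n, hs 0]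
  · simpa using (tendsto_one_div_atTop_nhds_zero_nat (𝕜 := ℝ)).const_mul (2 * C)

variable {M : Measure Ω} [IsProbabilityMeasure M] {T : Ω → Ω}

lemma integrable_of_abs_le {f : Ω → ℝ} (hf : Measurable f) (C : ℝ) (h : ∀ ω, |f ω| ≤ C) :
    Integrable f M :=
  Integrable.of_bound hf.aestronglyMeasurable C (Eventually.of_forall h)

lemma max_ergodic (hT : MeasurePreserving T M M) {φ : Ω → ℝ} (hφ : Measurable φ) (C : ℝ)
    (hC : ∀ ω, |φ ω| ≤ C)
    (hpos : ∀ ω, ∃ n, 0 < ∑ m ∈ Finset.range n, φ (T^[m] ω)) : 0 ≤ ∫ ω, φ ω ∂M := by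
  have hWm : ∀ N, Measurable (maxW T φ N) := by
    intro N
    induction N with
    | zero => exact measurable_const
    | succ N ih => exact measurable_const.max (hφ.add (ih.comp hT.measurable))
  have hW0 : ∀ N ω, 0 ≤ maxW T φ N ω := by
    intro N ω
    cases N with
    | zero => exact le_rfl
    | succ N => exact le_max_left _ _
  have hWb : ∀ N ω, maxW T φ N ω ≤ N * C := by
    intro N
    induction N with
    | zero => intro ω; simp [maxW]
    | succ N ih =>
      intro ω
      have h1 := (abs_le.1 (hC ω)).2
      have h2 := ih (T ω)
      have h3 := hW0 N (T ω)
      have h4 : 0 ≤ C := (abs_nonneg _).trans (hC ω)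
      push_cast
      exact max_le (by positivity) (by linarith)
  have hmono : ∀ N ω, maxW T φ N ω ≤ maxW T φ (N + 1) ω := by
    intro N
    induction N with
    | zero => intro ω; exact hW0 1 ω
    | succ N ih => intro ω; exact max_le_max le_rfl (by linarith [ih (T ω)])
  have hmono' : ∀ ω, Monotone fun N => maxW T φ N ω := fun ω =>
    monotone_nat_of_le_succ fun N => hmono N ω
  have hS : ∀ n ω, ∑ m ∈ Finset.range n, φ (T^[m] ω) ≤ maxW T φ n ω := by
    intro n
    induction n with
    | zero => intro ω; simp [maxW]
    | succ n ih =>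
      intro ω
      rw [Finset.sum_range_succ']
      have := ih (T ω)
      simp only [Function.iterate_succ, Function.comp, Function.iterate_zero, id] at this ⊢
      exact le_max_of_le_right (by linarith)
  have hint : ∀ N, Integrable (maxW T φ N) M := fun N =>
    integrable_of_abs_le (hWm N) (N * C) fun ω => by
      rw [abs_of_nonneg (hW0 N ω)]; exact hWb N ω
  have hset : ∀ N, MeasurableSet {ω | 0 < maxW T φ N ω} := fun N =>
    measurableSet_lt measurable_const (hWm N)
  have key : ∀ N, 0 ≤ ∫ ω, ({ω | 0 < maxW T φ (N+1) ω}.indicator φ) ω ∂M := by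
    intro N
    have h1 : ∫ ω, (maxW T φ (N+1) ω - maxW T φ (N+1) (T ω)) ∂M = 0 := by
      have hc : Integrable (fun ω => maxW T φ (N+1) (T ω)) M :=
        hT.integrable_comp_of_integrable (hint _)
      rw [integral_sub (hint _) hc]
      have : ∫ ω, maxW T φ (N+1) (T ω) ∂M = ∫ ω, maxW T φ (N+1) ω ∂M := by
        conv_rhs => rw [← hT.map_eq]
        rw [integral_map hT.measurable.aemeasurable (hWm _).aestronglyMeasurable]
      rw [this, sub_self]
    have hc : Integrable (fun ω => maxW T φ (N+1) ω - maxW T φ (N+1) (T ω)) M :=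
      (hint _).sub (hT.integrable_comp_of_integrable (hint _))
    refine h1.symm.le.trans (integral_mono hc ?_ ?_)
    · exact (integrable_of_abs_le hφ C hC).indicator (hset _)
    · intro ω
      by_cases h : 0 < maxW T φ (N+1) ω
      · rw [Set.indicator_of_mem (by exact h)]
        have h2 : maxW T φ (N+1) ω = φ ω + maxW T φ N (T ω) := by
          have : maxW T φ (N+1) ω = max 0 (φ ω + maxW T φ N (T ω)) := rfl
          rw [this] at h ⊢
          rcases max_choice 0 (φ ω + maxW T φ N (T ω)) with h' | h'
          · rw [h'] at h; exact absurd h (lt_irrefl _)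
          · exact h'
        have := hmono N (T ω)
        dsimp only
        linarith
      · rw [Set.indicator_of_notMem (by exact h)]
        have := hW0 (N+1) (T ω)
        dsimp only
        linarith
  have hlim : Tendsto (fun N => ∫ ω, ({ω | 0 < maxW T φ (N+1) ω}.indicator φ) ω ∂M) atTop
      (nhds (∫ ω, φ ω ∂M)) := by
    apply tendsto_integral_of_dominated_convergence (fun _ => C)
    · exact fun N => (hφ.indicator (hset _)).aestronglyMeasurable
    · exact integrable_const _
    · intro N
      refine Eventually.of_forall fun ω => ?_
      exact (norm_indicator_le_norm_self _ _).trans (hC ω)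
    · refine Eventually.of_forall fun ω => ?_
      obtain ⟨n, hn⟩ := hpos ω
      apply tendsto_const_nhds.congr'
      filter_upwards [eventually_ge_atTop n] with N hN
      rw [Set.indicator_of_mem]
      exact (hn.trans_le (hS n ω)).trans_le (hmono' ω (by omega))
  exact ge_of_tendsto' hlim key

lemma measurable_bavg (hT : Measurable T) {f : Ω → ℝ} (hf : Measurable f) (n : ℕ) :
    Measurable fun ω => bavg T f ω n := by
  unfold bavg
  refine measurable_const.mul (Finset.measurable_sum _ fun m _ => hf.comp (hT.iterate m))

lemma birk_half (hT : MeasurePreserving T M M) {f : Ω → ℝ} (hf : Measurable f)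
    (h1 : ∀ ω, |f ω| ≤ 1) : ∫ ω, f ω ∂M ≤ ∫ ω, atTop.liminf (bavg T f ω) ∂M := by
  set F : Ω → ℝ := fun ω => atTop.liminf (bavg T f ω) with hF
  have hAb : ∀ ω n, |bavg T f ω n| ≤ 1 := fun ω n =>
    abs_avg_le 1 zero_le_one _ (fun m => h1 _) n
  have hFm : Measurable F := Measurable.liminf fun n => measurable_bavg hT.measurable hf n
  have hFb : ∀ ω, |F ω| ≤ 1 := fun ω => liminf_abs_le 1 (hAb ω)
  have hFT : ∀ ω, F (T ω) = F ω := by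
    intro ω
    apply liminf_eq_of_tendsto 1 (hAb _) (hAb _)
    have := tendsto_avg_shift 1 (fun m => f (T^[m] ω)) fun m => h1 _
    simpa only [bavg, Function.iterate_succ, Function.comp] using this
  have hFTm : ∀ m ω, F (T^[m] ω) = F ω := by
    intro m
    induction m with
    | zero => intro ω; rfl
    | succ m ih => intro ω; rw [Function.iterate_succ, Function.comp, ih, hFT]
  apply le_of_forall_pos_le_add
  intro ε hε
  have hmain := max_ergodic (M := M) (T := T) hT (φ := fun ω => F ω - f ω + ε)
    ((hFm.sub hf).add_const ε) (2 + ε) ?_ ?_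
  · have hi1 := integrable_of_abs_le (M := M) hFm 1 hFb
    have hi2 := integrable_of_abs_le (M := M) hf 1 h1
    have hi3 : Integrable (fun ω => F ω - f ω) M := hi1.sub hi2
    rw [integral_add hi3 (integrable_const _), integral_sub hi1 hi2] at hmain
    simp at hmain
    linarith
  · intro ω
    have a := abs_le.1 (hFb ω)
    have b := abs_le.1 (h1 ω)
    rw [abs_le]; constructor <;> linarith
  · intro ω
    have cu : IsCoboundedUnder (· ≥ ·) atTop (bavg T f ω) :=
      (isBoundedUnder_of ⟨1, fun n => (abs_le.1 (hAb ω n)).2⟩ :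
        IsBoundedUnder (· ≤ ·) atTop (bavg T f ω)).isCoboundedUnder_ge
    have hfr := frequently_lt_of_liminf_lt (u := bavg T f ω) (b := F ω + ε) cu
      (by simp only [hF]; linarith)
    obtain ⟨n, hn, hn1⟩ := (hfr.and_eventually (eventually_ge_atTop 1)).exists
    refine ⟨n, ?_⟩
    have hn' : (0:ℝ) < n := by exact_mod_cast hn1
    simp only [hFTm, Finset.sum_add_distrib, Finset.sum_sub_distrib, Finset.sum_const,
      Finset.card_range, nsmul_eq_mul]
    rw [bavg, one_div, inv_mul_lt_iff₀ hn'] at hn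
    linarith

lemma birkhoff (hT : MeasurePreserving T M M) {f : Ω → ℝ} (hf : Measurable f)
    (h1 : ∀ ω, |f ω| ≤ 1) :
    (∀ᵐ ω ∂M, Tendsto (bavg T f ω) atTop (nhds (atTop.liminf (bavg T f ω)))) ∧
    ∫ ω, atTop.liminf (bavg T f ω) ∂M = ∫ ω, f ω ∂M := by
  have hAb : ∀ ω n, |bavg T f ω n| ≤ 1 := fun ω n =>
    abs_avg_le 1 zero_le_one _ (fun m => h1 _) n
  have hneg : ∀ ω n, bavg T (fun ω => - f ω) ω n = - bavg T f ω n := by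
    intro ω n; simp [bavg]
  have hAb' : ∀ ω n, |bavg T (fun ω => - f ω) ω n| ≤ 1 := fun ω n => by
    rw [hneg, abs_neg]; exact hAb ω n
  have e1 := birk_half hT hf h1
  have e2 := birk_half hT (f := fun ω => - f ω) hf.neg (fun ω => by rw [abs_neg]; exact h1 ω)
  have m1 : Measurable fun ω => atTop.liminf (bavg T f ω) :=
    Measurable.liminf fun n => measurable_bavg hT.measurable hf n
  have m2 : Measurable fun ω => atTop.liminf (bavg T (fun ω => - f ω) ω) :=
    Measurable.liminf fun n => measurable_bavg hT.measurable hf.neg n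
  have i1 := integrable_of_abs_le (M := M) m1 1 (fun ω => liminf_abs_le 1 (hAb ω))
  have i2 := integrable_of_abs_le (M := M) m2 1 (fun ω => liminf_abs_le 1 (hAb' ω))
  have ev1 : ∀ ω δ, 0 < δ → ∀ᶠ n in atTop, atTop.liminf (bavg T f ω) - δ < bavg T f ω n := by
    intro ω δ hδ
    exact eventually_lt_of_lt_liminf (by linarith)
      (isBoundedUnder_of ⟨-1, fun n => (abs_le.1 (hAb ω n)).1⟩)
  have ev2 : ∀ ω δ, 0 < δ → ∀ᶠ n in atTop,
      atTop.liminf (bavg T (fun ω => - f ω) ω) - δ < - bavg T f ω n := by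
    intro ω δ hδ
    have := eventually_lt_of_lt_liminf (f := atTop) (u := bavg T (fun ω => - f ω) ω)
      (b := atTop.liminf (bavg T (fun ω => - f ω) ω) - δ) (by linarith)
      (isBoundedUnder_of ⟨-1, fun n => (abs_le.1 (hAb' ω n)).1⟩)
    simpa only [hneg] using this
  have hsum : ∀ ω, 0 ≤ -(atTop.liminf (bavg T f ω) + atTop.liminf (bavg T (fun ω => - f ω) ω)) := by
    intro ω
    rw [neg_nonneg]
    apply le_of_forall_pos_le_add
    intro ε hε
    obtain ⟨n, a, b⟩ := ((ev1 ω (ε/2) (by linarith)).and (ev2 ω (ε/2) (by linarith))).exists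
    linarith
  have hI : ∫ ω, -(atTop.liminf (bavg T f ω) + atTop.liminf (bavg T (fun ω => - f ω) ω)) ∂M
      = -(∫ ω, atTop.liminf (bavg T f ω) ∂M +
        ∫ ω, atTop.liminf (bavg T (fun ω => - f ω) ω) ∂M) := by
    rw [integral_neg, integral_add i1 i2]
  have hpos := integral_nonneg (μ := M) (Pi.le_def.2 hsum)
  rw [hI] at hpos
  rw [integral_neg] at e2
  refine ⟨?_, by linarith⟩
  have hz : ∫ ω, -(atTop.liminf (bavg T f ω) + atTop.liminf (bavg T (fun ω => - f ω) ω)) ∂M = 0 := by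
    rw [hI]; linarith
  rw [integral_eq_zero_iff_of_nonneg (Pi.le_def.2 hsum) (i1.add i2).neg] at hz
  filter_upwards [hz] with ω hω
  simp only [Pi.zero_apply] at hω
  rw [tendsto_order]
  constructor
  · intro a ha
    filter_upwards [ev1 ω (atTop.liminf (bavg T f ω) - a) (by linarith)] with n hn
    linarith
  · intro a ha
    filter_upwards [ev2 ω (a - atTop.liminf (bavg T f ω)) (by linarith)] with n hn
    linarith

end Birk
end Part1

section Part2
noncomputable abbrev vU : Measure ℝ := volume.restrict (Set.Ico (0:ℝ) 1)

instance : IsProbabilityMeasure vU := ⟨by simp [vU]⟩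

noncomputable abbrev lamU : Measure (ℕ → ℝ) := Measure.infinitePi (fun _ : ℕ => vU)

lemma vU_split (E : Set ℝ) (hE : MeasurableSet E) :
    vU E = (1/2) * vU ((fun y => y / 2) ⁻¹' E) + (1/2) * vU ((fun y => (y + 1) / 2) ⁻¹' E) := by
  have m1 : Measurable fun y : ℝ => y / 2 := by fun_prop
  have m2 : Measurable fun y : ℝ => (y+1) / 2 := by fun_prop
  rw [Measure.restrict_apply hE, Measure.restrict_apply (m1 hE), Measure.restrict_apply (m2 hE)]
  have e1 : (fun y : ℝ => y / 2) ⁻¹' E ∩ Set.Ico 0 1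
      = (fun y : ℝ => y * (1/2)) ⁻¹' (E ∩ Set.Ico 0 (1/2)) := by
    ext y; simp only [Set.mem_inter_iff, Set.mem_preimage, Set.mem_Ico]
    rw [show y * (1/2) = y / 2 by ring]
    refine and_congr_right fun _ => ⟨fun h => ⟨by linarith, by linarith⟩, fun h => ⟨by linarith, by linarith⟩⟩
  have e2 : (fun y : ℝ => (y+1) / 2) ⁻¹' E ∩ Set.Ico 0 1
      = (fun y : ℝ => y + 1) ⁻¹' ((fun y : ℝ => y * (1/2)) ⁻¹' (E ∩ Set.Ico (1/2) 1)) := by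
    ext y; simp only [Set.mem_inter_iff, Set.mem_preimage, Set.mem_Ico]
    rw [show (y+1) * (1/2) = (y+1) / 2 by ring]
    refine and_congr_right fun _ => ⟨fun h => ⟨by linarith, by linarith⟩, fun h => ⟨by linarith, by linarith⟩⟩
  rw [e1, e2, measure_preimage_add_right, Real.volume_preimage_mul_right (by norm_num),
    Real.volume_preimage_mul_right (by norm_num)]
  have h2 : ENNReal.ofReal |(1/2 : ℝ)⁻¹| = 2 := by
    rw [abs_of_pos (by norm_num)]; norm_num
  rw [h2, ← mul_assoc, ← mul_assoc]
  have h3 : (1/2 : ENNReal) * 2 = 1 := by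
    rw [one_div]; exact ENNReal.inv_mul_cancel (by norm_num) (by norm_num)
  rw [h3, one_mul, one_mul, ← measure_union]
  · congr 1
    rw [← Set.inter_union_distrib_left, Set.Ico_union_Ico_eq_Ico (by norm_num) (by norm_num)]
  · rw [Set.disjoint_left]
    rintro x ⟨_, hx⟩ ⟨_, hx'⟩
    exact absurd hx.2 (not_lt.2 hx'.1)
  · exact hE.inter measurableSet_Ico

noncomputable def coin : Measure ℝ :=
  (1/2 : ENNReal) • Measure.dirac 0 + (1/2 : ENNReal) • Measure.dirac 1

instance : IsProbabilityMeasure coin := ⟨by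
  simp [coin, ENNReal.inv_two_add_inv_two]⟩

lemma digitR_half_succ (y : ℝ) (i : ℕ) : digitR (y / 2) (i + 1) = digitR y i := by
  unfold digitR
  rw [show y / 2 * 2 ^ (i + 1 + 1) = y * 2 ^ (i+1) by ring]

lemma digitR_half_succ' (y : ℝ) (i : ℕ) : digitR ((y+1) / 2) (i + 1) = digitR y i := by
  unfold digitR
  have : (y + 1) / 2 * 2 ^ (i + 1 + 1) = y * 2 ^ (i+1) + ((2 ^ (i+1) : ℤ) : ℝ) := by
    push_cast; ring
  rw [this, Int.floor_add_intCast]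
  have : (⌊y * 2 ^ (i + 1)⌋ + 2 ^ (i + 1)) % 2 = ⌊y * 2 ^ (i + 1)⌋ % 2 := by
    rw [pow_succ]; omega
  rw [this]

lemma measurable_digitR (i : ℕ) : Measurable fun x => digitR x i := by
  unfold digitR
  refine Measurable.ite ?_ measurable_const measurable_const
  have : Measurable fun x : ℝ => ⌊x * 2 ^ (i+1)⌋ % 2 :=
    (measurable_of_countable (fun z : ℤ => z % 2)).comp (Int.measurable_floor.comp (by fun_prop))
  exact this (measurableSet_singleton 1)

lemma digits_box (n : ℕ) : ∀ t : ℕ → Set ℝ, (∀ i, MeasurableSet (t i)) →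
    vU {x | ∀ i < n, digitR x i ∈ t i} = ∏ i ∈ Finset.range n, coin (t i) := by
  classical
  induction n with
  | zero => intro t _; simp
  | succ n ih =>
    intro t ht
    have hm : MeasurableSet {x | ∀ i < n + 1, digitR x i ∈ t i} := by
      simp only [Set.ofPred_forall]
      exact MeasurableSet.iInter fun i => MeasurableSet.iInter fun _ => measurable_digitR i (ht i)
    rw [vU_split _ hm, Finset.prod_range_succ']
    have ih' := ih (fun i => t (i+1)) (fun i => ht _)
    have a1 : vU ((fun y => y / 2) ⁻¹' {x | ∀ i < n + 1, digitR x i ∈ t i})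
        = Measure.dirac 0 (t 0) * ∏ i ∈ Finset.range n, coin (t (i+1)) := by
      rw [← ih', Measure.dirac_apply' _ (ht 0)]
      have hae : ((fun y => y / 2) ⁻¹' {x | ∀ i < n + 1, digitR x i ∈ t i} : Set ℝ) =ᵐ[vU]
          ({y | (0:ℝ) ∈ t 0 ∧ ∀ i < n, digitR y i ∈ t (i+1)} : Set ℝ) := by
        rw [eventuallyEq_set]
        filter_upwards [ae_restrict_mem measurableSet_Ico] with y hy
        simp only [Set.mem_preimage, Set.mem_ofPred_eq]
        have h0 : digitR (y/2) 0 = 0 := by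
          unfold digitR
          have : ⌊y / 2 * 2 ^ (0+1)⌋ = 0 := by
            rw [Int.floor_eq_zero_iff]; constructor <;> simp <;> linarith [hy.1, hy.2]
          rw [this]; norm_num
        rw [Nat.forall_lt_succ_left, h0]
        simp only [digitR_half_succ]
      rw [measure_congr hae]
      by_cases h : (0:ℝ) ∈ t 0 <;> simp [h]
    have a2 : vU ((fun y => (y+1) / 2) ⁻¹' {x | ∀ i < n + 1, digitR x i ∈ t i})
        = Measure.dirac 1 (t 0) * ∏ i ∈ Finset.range n, coin (t (i+1)) := by
      rw [← ih', Measure.dirac_apply' _ (ht 0)]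
      have hae : ((fun y => (y+1) / 2) ⁻¹' {x | ∀ i < n + 1, digitR x i ∈ t i} : Set ℝ) =ᵐ[vU]
          ({y | (1:ℝ) ∈ t 0 ∧ ∀ i < n, digitR y i ∈ t (i+1)} : Set ℝ) := by
        rw [eventuallyEq_set]
        filter_upwards [ae_restrict_mem measurableSet_Ico] with y hy
        simp only [Set.mem_preimage, Set.mem_ofPred_eq]
        have h0 : digitR ((y+1)/2) 0 = 1 := by
          unfold digitR
          have : ⌊(y+1) / 2 * 2 ^ (0+1)⌋ = 1 := by
            rw [Int.floor_eq_iff]; constructor <;> simp <;> linarith [hy.1, hy.2]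
          rw [this]; norm_num
        rw [Nat.forall_lt_succ_left, h0]
        simp only [digitR_half_succ']
      rw [measure_congr hae]
      by_cases h : (1:ℝ) ∈ t 0 <;> simp [h]
    rw [a1, a2]
    simp only [coin, Measure.add_apply, Measure.smul_apply, smul_eq_mul]
    ring

lemma map_digits : vU.map (fun x i => digitR x i) = Measure.infinitePi (fun _ : ℕ => coin) := by
  classical
  apply Measure.eq_infinitePi
  intro s t ht
  rw [Measure.map_apply (measurable_pi_lambda _ measurable_digitR)
    (MeasurableSet.pi s.countable_toSet fun i _ => ht i)]
  obtain ⟨n, hn⟩ : ∃ n, s ⊆ Finset.range n := ⟨s.sup id + 1, fun i hi => by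
    rw [Finset.mem_range]; exact Nat.lt_succ_of_le (Finset.le_sup (f := id) hi)⟩
  have := digits_box n (fun i => if i ∈ s then t i else Set.univ)
    (fun i => by split_ifs; exacts [ht i, MeasurableSet.univ])
  rw [← Finset.prod_subset hn (fun i _ hi => by simp [hi])] at this
  convert this using 1
  · congr 1
    ext x
    simp only [Set.mem_preimage, Set.mem_pi, Finset.mem_coe, Set.mem_ofPred_eq]
    constructor
    · intro h i _
      split_ifs with hi
      · exact h i hi
      · trivial
    · intro h i hi
      have := h i (Finset.mem_range.1 (hn hi))
      rwa [if_pos hi] at this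
  · exact Finset.prod_congr rfl fun i hi => by simp [hi]

lemma digitR_mem (x : ℝ) (i : ℕ) : 0 ≤ digitR x i ∧ digitR x i ≤ 1 := by
  unfold digitR; split_ifs <;> norm_num

noncomputable def bsum (d : ℕ → ℝ) : ℝ := ∑' j : ℕ, (max 0 (min 1 (d j))) / 2 ^ (j + 1)

lemma measurable_bsum : Measurable bsum := by
  apply Continuous.measurable
  unfold bsum
  refine continuous_tsum (u := fun j : ℕ => (1/2 : ℝ) ^ (j+1)) (fun j => by fun_prop) ?_ ?_
  · exact (summable_nat_add_iff 1).2 (summable_geometric_of_lt_one (by norm_num) (by norm_num))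
  · intro j d
    rw [Real.norm_eq_abs, abs_of_nonneg (by positivity), one_div, inv_pow, div_eq_mul_inv]
    have : max 0 (min 1 (d j)) ≤ 1 := by simp
    have h2 : (0:ℝ) ≤ (2 ^ (j+1))⁻¹ := by positivity
    nlinarith

lemma unif_eq (x : ℝ) (m : ℕ) : unif x m = bsum (fun j => digitR x (Nat.pair m j)) := by
  unfold unif bsum
  congr 1; ext j
  have := digitR_mem x (Nat.pair m j)
  rw [min_eq_right this.2, max_eq_right this.1]

lemma partial_digits (x : ℝ) (hx : x ∈ Set.Ico (0:ℝ) 1) (n : ℕ) :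
    ∑ j ∈ Finset.range n, digitR x j / 2 ^ (j+1) = ⌊x * 2 ^ n⌋ / 2 ^ n := by
  induction n with
  | zero =>
    have : ⌊x * 2 ^ 0⌋ = 0 := by
      rw [Int.floor_eq_zero_iff]; simpa using hx
    simp only [this]; simp
  | succ n ih =>
    rw [Finset.sum_range_succ, ih]
    have key : (⌊x * 2 ^ (n+1)⌋ : ℝ) = 2 * ⌊x * 2 ^ n⌋ + digitR x n := by
      unfold digitR
      have e : x * 2 ^ (n+1) = 2 * (x * 2 ^ n) := by ring
      rw [e]
      generalize x * 2 ^ n = z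
      have h1 := Int.floor_le z
      have h2 := Int.lt_floor_add_one z
      have h3 := Int.floor_le (2 * z)
      have h4 := Int.lt_floor_add_one (2 * z)
      have h5 : 2 * ⌊z⌋ < ⌊2 * z⌋ + 1 := by
        have : ((2 * ⌊z⌋ : ℤ) : ℝ) < ((⌊2 * z⌋ + 1 : ℤ) : ℝ) := by push_cast; linarith
        exact_mod_cast this
      have h6 : ⌊2 * z⌋ < 2 * ⌊z⌋ + 2 := by
        have : ((⌊2 * z⌋ : ℤ) : ℝ) < ((2 * ⌊z⌋ + 2 : ℤ) : ℝ) := by push_cast; linarith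
        exact_mod_cast this
      split_ifs with h
      · have : ⌊2 * z⌋ = 2 * ⌊z⌋ + 1 := by omega
        rw [this]; push_cast; ring
      · have : ⌊2 * z⌋ = 2 * ⌊z⌋ := by omega
        rw [this]; push_cast; ring
    rw [key, pow_succ]
    field_simp

lemma bsum_digits (x : ℝ) (hx : x ∈ Set.Ico (0:ℝ) 1) : bsum (fun i => digitR x i) = x := by
  have h0 : ∀ j, (max 0 (min 1 (digitR x j))) / 2 ^ (j + 1) = digitR x j / 2 ^ (j+1) := by
    intro j
    have := digitR_mem x j
    rw [min_eq_right this.2, max_eq_right this.1]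
  unfold bsum
  simp_rw [h0]
  apply HasSum.tsum_eq
  rw [hasSum_iff_tendsto_nat_of_nonneg (fun j => div_nonneg (digitR_mem x j).1 (by positivity))]
  simp_rw [partial_digits x hx]
  rw [tendsto_iff_norm_sub_tendsto_zero]
  have hg : Tendsto (fun n : ℕ => (1/2 : ℝ) ^ n) atTop (nhds 0) :=
    tendsto_pow_atTop_nhds_zero_of_lt_one (by norm_num) (by norm_num)
  refine squeeze_zero (fun _ => norm_nonneg _) (fun n => ?_) hg
  have hp : (0:ℝ) < 2 ^ n := by positivity
  have : (⌊x * 2 ^ n⌋ : ℝ) / 2 ^ n - x = (⌊x * 2 ^ n⌋ - x * 2 ^ n) / 2 ^ n := by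
    field_simp
  rw [this, Real.norm_eq_abs, abs_div, abs_of_pos hp, div_le_iff₀ hp, one_div, inv_pow,
    inv_mul_cancel₀ hp.ne', abs_le]
  constructor <;> linarith [Int.floor_le (x * 2 ^ n), Int.lt_floor_add_one (x * 2 ^ n)]

lemma measurable_unif : Measurable fun x : ℝ => fun m => unif x m := by
  refine measurable_pi_lambda _ fun m => ?_
  simp_rw [unif_eq]
  exact measurable_bsum.comp (measurable_pi_lambda _ fun j => measurable_digitR _)

lemma map_bsum : (Measure.infinitePi (fun _ : ℕ => coin)).map bsum = vU := by
  rw [← map_digits, Measure.map_map measurable_bsum (measurable_pi_lambda _ measurable_digitR)]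
  have : (bsum ∘ fun x i => digitR x i) =ᵐ[vU] id := by
    filter_upwards [ae_restrict_mem measurableSet_Ico] with x hx
    exact bsum_digits x hx
  rw [Measure.map_congr this, Measure.map_id]

lemma map_unif : vU.map (fun x m => unif x m) = lamU := by
  have h1 : (fun x m => unif x m) = (fun (e : ℕ → ℕ → ℝ) m => bsum (e m)) ∘
      (MeasurableEquiv.curry ℕ ℕ ℝ) ∘ (fun (d : ℕ → ℝ) (p : ℕ × ℕ) => d (Nat.pairEquiv p)) ∘
      (fun x i => digitR x i) := by
    funext x m
    rw [unif_eq]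
    rfl
  have md : Measurable (fun x i => digitR x i) := measurable_pi_lambda _ measurable_digitR
  have mp : Measurable (fun (d : ℕ → ℝ) (p : ℕ × ℕ) => d (Nat.pairEquiv p)) := by fun_prop
  have mb : Measurable (fun (e : ℕ → ℕ → ℝ) m => bsum (e m)) :=
    measurable_pi_lambda _ fun m => measurable_bsum.comp (measurable_pi_apply m)
  rw [h1, ← Measure.map_map mb ((MeasurableEquiv.measurable _).comp (mp.comp md)),
    ← Measure.map_map (MeasurableEquiv.measurable _) (mp.comp md), ← Measure.map_map mp md,
    map_digits, Measure.map_infinitePi_infinitePi_of_inj Nat.pairEquiv.injective,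
    Measure.infinitePi_map_curry (fun _ _ => coin),
    Measure.infinitePi_map_pi (fun _ => Measure.infinitePi fun _ : ℕ => coin)
      (fun _ => measurable_bsum)]
  simp only [map_bsum]
end Part2

section Part3
/-! sampling -/

lemma measurable_sampleFin {n : ℕ} (hn : 0 < n) (p : Fin n → ℝ) :
    Measurable fun u => sampleFin hn p u := by
  classical
  let _ : MeasurableSpace (Finset (Fin n)) := ⊤
  let c : Fin n → ℝ := fun y => ∑ z ∈ Finset.univ.filter fun z : Fin n => z ≤ y, p z
  let φ : Finset (Fin n) → Fin n := fun s => if hs : s.Nonempty then s.min' hs else ⟨0, hn⟩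
  have h1 : Measurable fun u : ℝ => Finset.univ.filter fun y : Fin n => u < c y := by
    apply measurable_to_countable'
    intro s
    have : (fun u : ℝ => Finset.univ.filter fun y : Fin n => u < c y) ⁻¹' {s}
        = ⋂ y, {u | u < c y ↔ y ∈ s} := by
      ext u
      simp [Finset.ext_iff]
    rw [this]
    refine MeasurableSet.iInter fun y => ?_
    by_cases hy : y ∈ s
    · simp only [hy, iff_true]; exact measurableSet_Iio
    · simp only [hy, iff_false, not_lt]; exact measurableSet_Ici
  have h2 : Measurable φ := fun s _ => trivial
  have h3 := h2.comp h1
  convert h3 using 1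
  funext u
  simp only [sampleFin, φ, c, Function.comp]

lemma sampleFin_eq {n : ℕ} (hn : 0 < n) (p : Fin n → ℝ) (hp : ∀ y, 0 ≤ p y) (u : ℝ) (y : Fin n)
    (h1 : ∑ z ∈ Finset.univ.filter (fun z : Fin n => z < y), p z ≤ u)
    (h2 : u < ∑ z ∈ Finset.univ.filter (fun z : Fin n => z ≤ y), p z) :
    sampleFin hn p u = y := by
  classical
  unfold sampleFin
  have hy : y ∈ Finset.univ.filter (fun y : Fin n =>
      u < ∑ z ∈ Finset.univ.filter fun z : Fin n => z ≤ y, p z) := by simpa using h2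
  have hne : (Finset.univ.filter (fun y : Fin n =>
      u < ∑ z ∈ Finset.univ.filter fun z : Fin n => z ≤ y, p z)).Nonempty := ⟨y, hy⟩
  have : (Finset.univ.filter (fun y : Fin n =>
      u < ∑ z ∈ Finset.univ.filter fun z : Fin n => z ≤ y, p z)).min' hne = y := by
    apply le_antisymm (Finset.min'_le _ _ hy)
    apply Finset.le_min'
    intro z hz
    by_contra hzy
    push Not at hzy
    have hz' : u < ∑ w ∈ Finset.univ.filter fun w : Fin n => w ≤ z, p w := by
      simpa using hz
    refine absurd (hz'.trans_le ?_) (not_lt.2 h1)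
    apply Finset.sum_le_sum_of_subset_of_nonneg
    · intro w hw
      simp only [Finset.mem_filter, Finset.mem_univ, true_and] at hw ⊢
      exact hw.trans_lt hzy
    · intros; exact hp _
  convert this using 1
  rw [dif_pos (by convert hne)]

lemma map_sampleFin {n : ℕ} (hn : 0 < n) (p : Fin n → ℝ) (hp : ∀ y, 0 ≤ p y) (hs : ∑ y, p y = 1)
    (y : Fin n) : vU {u | sampleFin hn p u = y} = ENNReal.ofReal (p y) := by
  classical
  have hm : ∀ y, MeasurableSet {u | sampleFin hn p u = y} := fun y =>
    measurable_sampleFin hn p (measurableSet_singleton y)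
  have hge : ∀ y, ENNReal.ofReal (p y) ≤ vU {u | sampleFin hn p u = y} := by
    intro y
    set c := ∑ z ∈ Finset.univ.filter (fun z : Fin n => z < y), p z with hc
    have hc' : ∑ z ∈ Finset.univ.filter (fun z : Fin n => z ≤ y), p z = c + p y := by
      have : Finset.univ.filter (fun z : Fin n => z ≤ y)
          = insert y (Finset.univ.filter (fun z : Fin n => z < y)) := by
        ext z; simp [le_iff_eq_or_lt]
      rw [this, Finset.sum_insert (by simp), add_comm]
    have hc0 : 0 ≤ c := Finset.sum_nonneg fun _ _ => hp _
    have hc1 : c + p y ≤ 1 := by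
      rw [← hc', ← hs]
      exact Finset.sum_le_sum_of_subset_of_nonneg (Finset.filter_subset _ _) (fun _ _ _ => hp _)
    have : Set.Ico c (c + p y) ⊆ {u | sampleFin hn p u = y} := fun u hu =>
      sampleFin_eq hn p hp u y hu.1 (by rw [hc']; exact hu.2)
    calc ENNReal.ofReal (p y) = vU (Set.Ico c (c + p y)) := by
          rw [Measure.restrict_apply measurableSet_Ico, Set.inter_eq_left.2, Real.volume_Ico]
          · congr 1; ring
          · exact Set.Ico_subset_Ico hc0 hc1
      _ ≤ _ := measure_mono this
  have hsum : ∑ y, vU {u | sampleFin hn p u = y} = 1 := by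
    rw [← measure_univ (μ := vU), ← measure_biUnion_finset]
    · congr 1; ext u; simp
    · intro a _ b _ hab
      rw [Function.onFun, Set.disjoint_left]
      intro u hu hu'
      exact hab (hu.symm.trans hu')
    · exact fun y _ => hm y
  have hsum' : ∑ y, ENNReal.ofReal (p y) = 1 := by
    rw [← ENNReal.ofReal_sum_of_nonneg (fun _ _ => hp _), hs, ENNReal.ofReal_one]
  by_contra hne
  have hlt : ENNReal.ofReal (p y) < vU {u | sampleFin hn p u = y} := lt_of_le_of_ne (hge y) (Ne.symm hne)
  have : ∑ y, ENNReal.ofReal (p y) < ∑ y, vU {u | sampleFin hn p u = y} := by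
    rw [← Finset.add_sum_erase _ _ (Finset.mem_univ y),
      ← Finset.add_sum_erase Finset.univ (fun y => vU {u | sampleFin hn p u = y}) (Finset.mem_univ y)]
    apply ENNReal.add_lt_add_of_lt_of_le _ hlt (Finset.sum_le_sum fun z _ => hge z)
    exact ENNReal.sum_ne_top.2 fun _ _ => ENNReal.ofReal_ne_top
  rw [hsum, hsum'] at this
  exact lt_irrefl _ this

lemma vecMeasure_singleton {α : Type*} [Fintype α] [MeasurableSpace α] [MeasurableSingletonClass α]
    (p : α → ℝ) (y : α) : vecMeasure p {y} = ENNReal.ofReal (p y) := by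
  classical
  simp only [vecMeasure, Measure.coe_finsetSum, Finset.sum_apply, Measure.smul_apply, smul_eq_mul,
    Measure.dirac_apply' _ (measurableSet_singleton y)]
  rw [Finset.sum_eq_single y]
  · simp
  · intro b _ hb; simp [hb]
  · simp

namespace POMDP
variable (Γ : POMDP)

noncomputable def nxt (k : Γ.K) (a : Γ.A) (u : ℝ) : Γ.K := (sampleOn (Γ.q k a) u).1

def Q (k : Γ.K) (a : Γ.A) (k' : Γ.K) : ℝ := ∑ s, Γ.q k a (k', s)

lemma measurable_nxt (k : Γ.K) (a : Γ.A) : Measurable (Γ.nxt k a) := by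
  unfold nxt sampleOn
  have h : Measurable fun i => ((Fintype.equivFin (Γ.K × Γ.S)).symm i).1 := measurable_of_finite _
  exact h.comp (measurable_sampleFin _ _)

lemma Q_nonneg (k : Γ.K) (a : Γ.A) (k' : Γ.K) : 0 ≤ Γ.Q k a k' :=
  Finset.sum_nonneg fun _ _ => Γ.q_nonneg _ _ _

lemma Q_sum (k : Γ.K) (a : Γ.A) : ∑ k', Γ.Q k a k' = 1 := by
  rw [← Γ.q_sum k a, Fintype.sum_prod_type]; rfl

lemma map_nxt (k : Γ.K) (a : Γ.A) : vU.map (Γ.nxt k a) = vecMeasure (Γ.Q k a) := by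
  classical
  rw [Measure.ext_iff_singleton]
  intro k'
  rw [Measure.map_apply (Γ.measurable_nxt k a) (measurableSet_singleton _), vecMeasure_singleton]
  set e := Fintype.equivFin (Γ.K × Γ.S)
  have hpos : 0 < Fintype.card (Γ.K × Γ.S) := Fintype.card_pos
  have key : ∀ y : Γ.K × Γ.S, vU {u | sampleOn (Γ.q k a) u = y} = ENNReal.ofReal (Γ.q k a y) := by
    intro y
    have h := map_sampleFin hpos (fun i => Γ.q k a (e.symm i)) (fun _ => Γ.q_nonneg _ _ _)
      (by rw [← Γ.q_sum k a]; exact Equiv.sum_comp e.symm _) (e y)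
    simp only [Equiv.symm_apply_apply] at h
    rw [← h]
    congr 1
    ext u
    simp only [sampleOn, Set.mem_ofPred_eq]
    exact Equiv.symm_apply_eq _
  have : (Γ.nxt k a) ⁻¹' {k'} = ⋃ s ∈ (Finset.univ : Finset Γ.S),
      {u | sampleOn (Γ.q k a) u = (k', s)} := by
    ext u
    simp only [Set.mem_preimage, Set.mem_singleton_iff, nxt, Finset.mem_univ, Set.iUnion_true,
      Set.mem_iUnion, Set.mem_ofPred_eq]
    constructor
    · intro h; exact ⟨_, by rw [← h]⟩
    · rintro ⟨s, hs⟩; rw [hs]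
  rw [this, measure_biUnion_finset]
  · simp_rw [key]
    rw [← ENNReal.ofReal_sum_of_nonneg (fun _ _ => Γ.q_nonneg _ _ _)]
    rfl
  · intro s _ s' _ hss
    rw [Function.onFun, Set.disjoint_left]
    intro u hu hu'
    have : (k', s) = (k', s') := hu.symm.trans hu'
    exact hss (Prod.ext_iff.1 this).2
  · intro s _
    have hm : Measurable fun u => sampleOn (Γ.q k a) u := by
      unfold sampleOn
      exact (measurable_of_finite _).comp (measurable_sampleFin _ _)
    exact hm (measurableSet_singleton _)
end POMDP

/-! splice -/

def splice (N : ℕ) (w : (ℕ → ℝ) × (ℕ → ℝ)) : ℕ → ℝ := fun m => if m < N then w.1 m else w.2 (m - N)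

lemma measurable_splice (N : ℕ) : Measurable (splice N) := by
  refine measurable_pi_lambda _ fun m => ?_
  unfold splice
  by_cases h : m < N
  · simp only [h, if_true]; fun_prop
  · simp only [h, if_false]; fun_prop

lemma map_splice (N : ℕ) : (lamU.prod lamU).map (splice N) = lamU := by
  classical
  apply Measure.eq_infinitePi
  intro s t ht
  rw [Measure.map_apply (measurable_splice N) (MeasurableSet.pi s.countable_toSet fun i _ => ht i)]
  have : splice N ⁻¹' (Set.pi s t) = (Set.pi (s.filter (· < N) : Finset ℕ) t) ×ˢ
      (Set.pi (((s.filter (¬ · < N)).image (· - N) : Finset ℕ)) (fun j => t (j + N))) := by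
    ext w
    simp only [Set.mem_preimage, Set.mem_pi, Finset.mem_coe, Set.mem_prod, Finset.mem_filter,
      Finset.mem_image, splice]
    constructor
    · intro h
      constructor
      · rintro i ⟨hi, hN⟩
        have := h i hi
        rwa [if_pos hN] at this
      · rintro j ⟨i, ⟨hi, hN⟩, rfl⟩
        have := h i hi
        rw [if_neg hN] at this
        rwa [Nat.sub_add_cancel (not_lt.1 hN)]
    · rintro ⟨h1, h2⟩ i hi
      split_ifs with hN
      · exact h1 i ⟨hi, hN⟩
      · have := h2 (i - N) ⟨i, ⟨hi, hN⟩, rfl⟩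
        rwa [Nat.sub_add_cancel (not_lt.1 hN)] at this
  rw [this, Measure.prod_prod, Measure.infinitePi_pi _ (fun i _ => ht i),
    Measure.infinitePi_pi _ (fun i _ => ht _), Finset.prod_image,
    ← Finset.prod_filter_mul_prod_filter_not s (· < N)]
  · congr 1
    apply Finset.prod_congr rfl
    intro i hi
    rw [Nat.sub_add_cancel (not_lt.1 (Finset.mem_filter.1 hi).2)]
  · intro i hi j hj hij
    have h1 := (Finset.mem_filter.1 hi).2
    have h2 := (Finset.mem_filter.1 hj).2
    simp only at hij
    omega

lemma map_head_tail : lamU.map (fun u => (u 0, fun m => u (m+1))) = vU.prod lamU := by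
  have hm : Measurable (fun u : ℕ → ℝ => (u 0, fun m => u (m+1))) := by fun_prop
  conv_lhs => rw [← map_splice 1]
  rw [Measure.map_map hm (measurable_splice 1)]
  have : (fun u : ℕ → ℝ => (u 0, fun m => u (m+1))) ∘ splice 1
      = Prod.map (fun u : ℕ → ℝ => u 0) id := by
    funext w
    simp [splice, Prod.map]
  rw [this, ← Measure.map_prod_map _ _ (measurable_pi_apply 0) measurable_id, Measure.map_id,
    Measure.infinitePi_map_eval]
end Part3

section Part4
namespace POMDP
variable (Γ : POMDP)

/-- laws on initial state and seeds -/
noncomputable def PP (p : Γ.K → ℝ) : Measure (Γ.K × (ℕ → ℝ)) := (vecMeasure p).prod lamU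

noncomputable def step (a : Γ.A) (y : Γ.K × (ℕ → ℝ)) : Γ.K × (ℕ → ℝ) :=
  (Γ.nxt y.1 a (y.2 0), fun m => y.2 (m+1))

def upd (p : Γ.K → ℝ) (a : Γ.A) : Γ.K → ℝ := fun k' => ∑ k, p k * Γ.Q k a k'

lemma upd_belief {p : Γ.K → ℝ} (hp : IsBelief p) (a : Γ.A) : IsBelief (Γ.upd p a) := by
  refine ⟨fun k' => Finset.sum_nonneg fun k _ => mul_nonneg (hp.1 k) (Γ.Q_nonneg _ _ _), ?_⟩
  unfold upd
  rw [Finset.sum_comm]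
  simp_rw [← Finset.mul_sum, Γ.Q_sum, mul_one]
  exact hp.2

lemma vecMeasure_prob {p : Γ.K → ℝ} (hp : IsBelief p) : IsProbabilityMeasure (vecMeasure p) := by
  constructor
  simp only [vecMeasure, Measure.coe_finsetSum, Finset.sum_apply, Measure.smul_apply, smul_eq_mul,
    measure_univ, mul_one]
  rw [← ENNReal.ofReal_sum_of_nonneg (fun _ _ => hp.1 _), hp.2, ENNReal.ofReal_one]

instance (p : Γ.K → ℝ) : IsFiniteMeasure (vecMeasure p) := by
  constructor
  simp only [vecMeasure, Measure.coe_finsetSum, Finset.sum_apply, Measure.smul_apply, smul_eq_mul,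
    measure_univ, mul_one]
  exact ENNReal.sum_lt_top.2 fun _ _ => ENNReal.ofReal_lt_top

instance (p : Γ.K → ℝ) : IsFiniteMeasure (Γ.PP p) := by unfold PP; infer_instance

lemma PP_prob {p : Γ.K → ℝ} (hp : IsBelief p) : IsProbabilityMeasure (Γ.PP p) := by
  have := Γ.vecMeasure_prob hp
  unfold PP; infer_instance

lemma measurable_step' : Measurable fun z : Γ.A × (Γ.K × (ℕ → ℝ)) => Γ.step z.1 z.2 := by
  refine measurable_from_prod_countable_right fun a => measurable_from_prod_countable_right fun k => ?_
  unfold step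
  exact ((Γ.measurable_nxt k a).comp (measurable_pi_apply 0)).prodMk (by fun_prop)

lemma measurable_step (a : Γ.A) : Measurable (Γ.step a) := by
  refine measurable_from_prod_countable_right fun k => ?_
  unfold step
  exact ((Γ.measurable_nxt k a).comp (measurable_pi_apply 0)).prodMk (by fun_prop)

lemma PP_apply (p : Γ.K → ℝ) {s : Set (Γ.K × (ℕ → ℝ))} (hs : MeasurableSet s) :
    Γ.PP p s = ∑ k, ENNReal.ofReal (p k) * lamU (Prod.mk k ⁻¹' s) := by
  rw [PP, Measure.prod_apply hs, vecMeasure, lintegral_finsetSum_measure]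
  simp [lintegral_smul_measure]

lemma map_step_point (k : Γ.K) (a : Γ.A) :
    lamU.map (fun u => Γ.step a (k, u)) = (vecMeasure (Γ.Q k a)).prod lamU := by
  have : (fun u : ℕ → ℝ => Γ.step a (k, u)) = (Prod.map (Γ.nxt k a) id) ∘
      (fun u : ℕ → ℝ => (u 0, fun m => u (m+1))) := by
    funext u; rfl
  rw [this, ← Measure.map_map ((Γ.measurable_nxt k a).prodMap measurable_id) (by fun_prop),
    map_head_tail, ← Measure.map_prod_map _ _ (Γ.measurable_nxt k a) measurable_id, Measure.map_id,
    map_nxt]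

lemma map_step {p : Γ.K → ℝ} (hp : IsBelief p) (a : Γ.A) :
    (Γ.PP p).map (Γ.step a) = Γ.PP (Γ.upd p a) := by
  ext s hs
  rw [Measure.map_apply (Γ.measurable_step a) hs, Γ.PP_apply p (Γ.measurable_step a hs),
    Γ.PP_apply _ hs]
  have : ∀ k, lamU (Prod.mk k ⁻¹' (Γ.step a ⁻¹' s)) =
      ∑ k', ENNReal.ofReal (Γ.Q k a k') * lamU (Prod.mk k' ⁻¹' s) := by
    intro k
    have h1 := congrArg (fun ν => ν s) (Γ.map_step_point k a)
    have hm : Measurable fun u : ℕ → ℝ => Γ.step a (k, u) :=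
      (Γ.measurable_step a).comp measurable_prodMk_left
    simp only [Measure.map_apply hm hs] at h1
    exact h1.trans (Γ.PP_apply (Γ.Q k a) hs)
  simp_rw [this, Finset.mul_sum]
  rw [Finset.sum_comm]
  refine Finset.sum_congr rfl fun k' _ => ?_
  rw [upd, ENNReal.ofReal_sum_of_nonneg (fun k _ => mul_nonneg (hp.1 k) (Γ.Q_nonneg _ _ _)),
    Finset.sum_mul]
  refine Finset.sum_congr rfl fun k _ => ?_
  rw [ENNReal.ofReal_mul (hp.1 k), mul_assoc]

/-! trajectories -/

noncomputable def st (a : ℕ → Γ.A) (y : Γ.K × (ℕ → ℝ)) : ℕ → Γ.K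
  | 0 => y.1
  | m + 1 => Γ.nxt (st a y m) (a m) (y.2 m)

noncomputable def av (a : ℕ → Γ.A) (y : Γ.K × (ℕ → ℝ)) (n : ℕ) : ℝ :=
  (1 / n : ℝ) * ∑ m ∈ Finset.range n, Γ.g (Γ.st a y m) (a m)

noncomputable def LL (a : ℕ → Γ.A) (y : Γ.K × (ℕ → ℝ)) : ℝ := atTop.liminf (Γ.av a y)

noncomputable def seed (ω : Γ.Env) : Γ.K × (ℕ → ℝ) := (ω.1, fun m => unif ω.2 m)

lemma measurable_seed : Measurable Γ.seed :=
  measurable_fst.prodMk (measurable_unif.comp measurable_snd)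

lemma map_seed (p : Γ.K → ℝ) : (Γ.envMeasure p).map Γ.seed = Γ.PP p := by
  have : Γ.seed = Prod.map id (fun x m => unif x m) := rfl
  rw [this, envMeasure, ← Measure.map_prod_map _ _ measurable_id measurable_unif, Measure.map_id]
  change (vecMeasure p).prod (vU.map _) = _
  rw [map_unif, PP]

lemma traj_blind (a : ℕ → Γ.A) (ω : Γ.Env) (m : ℕ) :
    (Γ.traj (Γ.blindStrat a) ω m).1 = Γ.st a (Γ.seed ω) m ∧
    (Γ.traj (Γ.blindStrat a) ω m).2.length = m := by
  induction m with
  | zero => exact ⟨rfl, rfl⟩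
  | succ m ih =>
    have ha : Γ.blindStrat a (Γ.traj (Γ.blindStrat a) ω m).2 = a m := by
      exact congrArg a ih.2
    simp only [traj, ha, ih.1, List.length_append, ih.2]
    exact ⟨rfl, rfl⟩

lemma state_blind (a : ℕ → Γ.A) (ω : Γ.Env) (m : ℕ) :
    Γ.state (Γ.blindStrat a) ω m = Γ.st a (Γ.seed ω) m := (Γ.traj_blind a ω m).1

lemma avg_blind (a : ℕ → Γ.A) (ω : Γ.Env) : Γ.avg (Γ.blindStrat a) ω = Γ.av a (Γ.seed ω) := by
  funext n
  unfold avg av rew act hist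
  congr 1
  refine Finset.sum_congr rfl fun m _ => ?_
  rw [Γ.state_blind]
  congr 1
  unfold blindStrat
  have := (Γ.traj_blind a ω m).2
  unfold blindStrat at this
  rw [this]

def detHist (s0 : Γ.S) (σ : Γ.Strategy) : ℕ → Γ.Hist
  | 0 => []
  | m + 1 => detHist s0 σ m ++ [(σ (detHist s0 σ m), s0)]

lemma traj_gen (hΓ : Γ.Blind) (s0 : Γ.S) (σ : Γ.Strategy) (ω : Γ.Env) (m : ℕ) :
    Γ.traj σ ω m = (Γ.st (fun m => σ (Γ.detHist s0 σ m)) (Γ.seed ω) m, Γ.detHist s0 σ m) := by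
  have hsub : ∀ s : Γ.S, s = s0 := by
    intro s
    have h : Γ.nS = 1 := hΓ
    apply Fin.ext
    have h1 := s.2
    have h2 := s0.2
    omega
  induction m with
  | zero => rfl
  | succ m ih =>
    simp only [traj, ih, detHist, st, nxt, seed]
    rw [hsub (Prod.snd _)]

lemma avg_gen (hΓ : Γ.Blind) (σ : Γ.Strategy) :
    ∃ a : ℕ → Γ.A, ∀ ω, Γ.avg σ ω = Γ.av a (Γ.seed ω) := by
  refine ⟨fun m => σ (Γ.detHist ⟨0, Γ.hS⟩ σ m), fun ω => ?_⟩
  funext n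
  unfold avg av rew act hist state
  congr 1
  refine Finset.sum_congr rfl fun m _ => ?_
  rw [Γ.traj_gen hΓ ⟨0, Γ.hS⟩]

lemma st_step (a : ℕ → Γ.A) (y : Γ.K × (ℕ → ℝ)) (m : ℕ) :
    Γ.st a y (m+1) = Γ.st (fun i => a (i+1)) (Γ.step (a 0) y) m := by
  induction m with
  | zero => rfl
  | succ m ih => 
    rw [st, ih]; rfl

lemma abs_g (k : Γ.K) (a : Γ.A) : |Γ.g k a| ≤ 1 := by
  rw [abs_of_nonneg (Γ.g_nonneg _ _)]; exact Γ.g_le_one _ _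

lemma abs_av (a : ℕ → Γ.A) (y : Γ.K × (ℕ → ℝ)) (n : ℕ) : |Γ.av a y n| ≤ 1 :=
  abs_avg_le 1 zero_le_one _ (fun _ => Γ.abs_g _ _) n

lemma abs_LL (a : ℕ → Γ.A) (y : Γ.K × (ℕ → ℝ)) : |Γ.LL a y| ≤ 1 :=
  liminf_abs_le 1 (Γ.abs_av a y)

lemma LL_step (a : ℕ → Γ.A) (y : Γ.K × (ℕ → ℝ)) :
    Γ.LL (fun i => a (i+1)) (Γ.step (a 0) y) = Γ.LL a y := by
  apply liminf_eq_of_tendsto 1 (Γ.abs_av _ _) (Γ.abs_av _ _)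
  have := tendsto_avg_shift 1 (fun m => Γ.g (Γ.st a y m) (a m)) (fun _ => Γ.abs_g _ _)
  simpa only [av, st_step] using this

lemma meas_two {X Y Z : Type*} [MeasurableSpace X] [MeasurableSpace Y] [Countable Y]
    [MeasurableSingletonClass Y]
    [MeasurableSpace Z] {F : Y → ℝ → Z} (hF : ∀ k, Measurable (F k)) {k : X → Y} {u : X → ℝ}
    (hk : Measurable k) (hu : Measurable u) : Measurable fun x => F (k x) (u x) := by
  have h : Measurable fun z : Y × ℝ => F z.1 z.2 :=
    measurable_from_prod_countable_right fun k => hF k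
  exact h.comp (hk.prodMk hu)

lemma measurable_nxt_comp {X : Type*} [MeasurableSpace X] (a : Γ.A) {k : X → Γ.K} {u : X → ℝ}
    (hk : Measurable k) (hu : Measurable u) : Measurable fun x => Γ.nxt (k x) a (u x) :=
  meas_two (F := fun k u => Γ.nxt k a u) (fun k => Γ.measurable_nxt k a) hk hu

lemma st_succ (a : ℕ → Γ.A) (y : Γ.K × (ℕ → ℝ)) (m : ℕ) :
    Γ.st a y (m+1) = Γ.nxt (Γ.st a y m) (a m) (y.2 m) := rfl

lemma measurable_st (a : ℕ → Γ.A) (m : ℕ) : Measurable fun y => Γ.st a y m := by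
  induction m with
  | zero => exact measurable_fst
  | succ m ih =>
    simp only [st_succ]
    exact Γ.measurable_nxt_comp (a m) ih ((measurable_pi_apply m).comp measurable_snd)

lemma measurable_av (a : ℕ → Γ.A) (n : ℕ) : Measurable fun y => Γ.av a y n := by
  unfold av
  refine measurable_const.mul (Finset.measurable_sum _ fun m _ => ?_)
  exact (measurable_of_finite fun k => Γ.g k (a m)).comp (Γ.measurable_st a m)

lemma measurable_LL (a : ℕ → Γ.A) : Measurable (Γ.LL a) :=
  Measurable.liminf fun n => Γ.measurable_av a n

noncomputable def pa (p : Γ.K → ℝ) (a : ℕ → Γ.A) : ℝ := ∫ y, Γ.LL a y ∂(Γ.PP p)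

lemma pay_gen (hΓ : Γ.Blind) (σ : Γ.Strategy) : ∃ a, ∀ p, Γ.pay p σ = Γ.pa p a := by
  obtain ⟨a, ha⟩ := Γ.avg_gen hΓ σ
  refine ⟨a, fun p => ?_⟩
  rw [pay, pa, ← Γ.map_seed, integral_map Γ.measurable_seed.aemeasurable
    (Γ.measurable_LL a).aestronglyMeasurable]
  simp_rw [ha]; rfl

lemma pay_blind (p : Γ.K → ℝ) (a : ℕ → Γ.A) : Γ.pay p (Γ.blindStrat a) = Γ.pa p a := by
  rw [pay, pa, ← Γ.map_seed, integral_map Γ.measurable_seed.aemeasurable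
    (Γ.measurable_LL a).aestronglyMeasurable]
  simp_rw [Γ.avg_blind]; rfl

lemma integral_PP {p : Γ.K → ℝ} (hp : ∀ k, 0 ≤ p k) {F : Γ.K × (ℕ → ℝ) → ℝ} (hF : Measurable F) (C : ℝ)
    (hC : ∀ y, |F y| ≤ C) : ∫ y, F y ∂(Γ.PP p) = ∑ k, p k * ∫ u, F (k, u) ∂lamU := by
  have hi : Integrable F (Γ.PP p) :=
    Integrable.of_bound hF.aestronglyMeasurable C (Eventually.of_forall hC)
  unfold PP at hi ⊢
  rw [integral_prod _ hi]
  unfold vecMeasure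
  rw [integral_finsetSum_measure]
  · refine Finset.sum_congr rfl fun k _ => ?_
    rw [integral_smul_measure, integral_dirac, ENNReal.toReal_ofReal (hp k), smul_eq_mul]
  · intro k _
    exact (integrable_dirac (by simp)).smul_measure ENNReal.ofReal_ne_top

lemma pa_eq {p : Γ.K → ℝ} (hp : ∀ k, 0 ≤ p k) (a : ℕ → Γ.A) :
    Γ.pa p a = ∑ k, p k * ∫ u, Γ.LL a (k, u) ∂lamU :=
  Γ.integral_PP hp (Γ.measurable_LL a) 1 (Γ.abs_LL a)

lemma pa_le_one {p : Γ.K → ℝ} (hp : IsBelief p) (a : ℕ → Γ.A) : Γ.pa p a ≤ 1 := by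
  have := Γ.PP_prob hp
  have h := norm_integral_le_of_norm_le_const (μ := Γ.PP p) (f := Γ.LL a) (C := 1)
    (Eventually.of_forall fun y => Γ.abs_LL a y)
  simp at h
  exact (abs_le.1 h).2

lemma pa_step {p : Γ.K → ℝ} (hp : IsBelief p) (a : ℕ → Γ.A) :
    Γ.pa (Γ.upd p (a 0)) (fun i => a (i+1)) = Γ.pa p a := by
  rw [pa, ← Γ.map_step hp, integral_map (Γ.measurable_step _).aemeasurable
    (Γ.measurable_LL _).aestronglyMeasurable]
  simp_rw [Γ.LL_step]; rfl

lemma le_val {p : Γ.K → ℝ} (hΓ : Γ.Blind) (hp : IsBelief p) (a : ℕ → Γ.A) : Γ.pa p a ≤ Γ.val p := by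
  rw [← Γ.pay_blind]
  apply le_ciSup (f := fun σ => Γ.pay p σ)
  refine ⟨1, ?_⟩
  rintro _ ⟨σ, rfl⟩
  obtain ⟨a, ha⟩ := Γ.pay_gen hΓ σ
  simp only [ha]
  exact Γ.pa_le_one hp a

lemma val_le {p : Γ.K → ℝ} (hΓ : Γ.Blind) (w : ℝ) (h : ∀ a, Γ.pa p a ≤ w) : Γ.val p ≤ w := by
  have : Nonempty Γ.Strategy := ⟨fun _ => ⟨0, Γ.hA⟩⟩
  apply ciSup_le
  intro σ
  obtain ⟨a, ha⟩ := Γ.pay_gen hΓ σ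
  rw [ha]; exact h a

/-- belief after `m` steps -/
def bel (p : Γ.K → ℝ) (a : ℕ → Γ.A) : ℕ → Γ.K → ℝ
  | 0 => p
  | m + 1 => bel (Γ.upd p (a 0)) (fun i => a (i+1)) m

lemma bel_belief (m : ℕ) : ∀ {p : Γ.K → ℝ} (_ : IsBelief p) (a : ℕ → Γ.A), IsBelief (Γ.bel p a m) := by
  induction m with
  | zero => intro p hp a; exact hp
  | succ m ih => intro p hp a; exact ih (Γ.upd_belief hp _) _

lemma map_st (m : ℕ) : ∀ {p : Γ.K → ℝ} (_ : IsBelief p) (a : ℕ → Γ.A),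
    (Γ.PP p).map (fun y => Γ.st a y m) = vecMeasure (Γ.bel p a m) := by
  induction m with
  | zero =>
    intro p hp a
    change (Γ.PP p).map Prod.fst = vecMeasure p
    rw [PP, Measure.map_fst_prod]
    simp
  | succ m ih =>
    intro p hp a
    rw [bel, ← ih (Γ.upd_belief hp _), ← Γ.map_step hp,
      Measure.map_map (Γ.measurable_st _ m) (Γ.measurable_step _)]
    congr 1
    funext y
    exact Γ.st_step a y m

lemma blindBelief_eq {p : Γ.K → ℝ} (hp : IsBelief p) (a : ℕ → Γ.A) (m : ℕ) :
    Γ.blindBelief p (Γ.blindStrat a) m = Γ.bel p a m := by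
  funext k
  have h := congrArg (fun ν => ν {k}) (Γ.map_st m hp a)
  simp only [vecMeasure_singleton] at h
  rw [Measure.map_apply (Γ.measurable_st a m) (measurableSet_singleton k), ← Γ.map_seed,
    Measure.map_apply Γ.measurable_seed (Γ.measurable_st a m (measurableSet_singleton k))] at h
  rw [blindBelief, prob]
  have e : {ω | Γ.state (Γ.blindStrat a) ω m = k} =
    Γ.seed ⁻¹' ((fun y => Γ.st a y m) ⁻¹' {k}) := by
    ext ω; simp [Γ.state_blind]
  rw [e, h, ENNReal.toReal_ofReal ((Γ.bel_belief m hp a).1 k)]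

lemma bel_congr (m : ℕ) : ∀ (p : Γ.K → ℝ) (a b : ℕ → Γ.A), (∀ i < m, a i = b i) →
    Γ.bel p a m = Γ.bel p b m := by
  induction m with
  | zero => intros; rfl
  | succ m ih =>
    intro p a b h
    rw [bel, bel, h 0 (by omega)]
    exact ih _ _ _ fun i hi => h (i+1) (by omega)

lemma pa_bel (m : ℕ) : ∀ {p : Γ.K → ℝ} (_ : IsBelief p) (a : ℕ → Γ.A),
    Γ.pa (Γ.bel p a m) (fun i => a (i+m)) = Γ.pa p a := by
  induction m with
  | zero => intro p hp a; rfl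
  | succ m ih =>
    intro p hp a
    rw [bel, ← Γ.pa_step hp a, ← ih (Γ.upd_belief hp (a 0))]
    congr 1

/-- From a reachable belief one cannot get more than the value. -/
lemma pa_reach_le (hΓ : Γ.Blind) {p : Γ.K → ℝ} (hp : IsBelief p) (a b : ℕ → Γ.A) (m : ℕ) :
    Γ.pa (Γ.bel p a m) b ≤ Γ.val p := by
  let c : ℕ → Γ.A := fun i => if i < m then a i else b (i - m)
  have h1 : Γ.bel p a m = Γ.bel p c m := Γ.bel_congr m p a c fun i hi => by simp [c, hi]
  have h2 : b = fun i => c (i+m) := by funext i; simp [c]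
  rw [h1, h2, Γ.pa_bel m hp c]
  exact Γ.le_val hΓ hp c

/-- Expected average. -/
lemma integral_av (m : ℕ) {p : Γ.K → ℝ} (hp : IsBelief p) (a : ℕ → Γ.A) :
    ∫ y, Γ.g (Γ.st a y m) (a m) ∂(Γ.PP p) = ∑ k, Γ.bel p a m k * Γ.g k (a m) := by
  have hm : Measurable fun k => Γ.g k (a m) := measurable_of_finite _
  have h := integral_map (μ := Γ.PP p) (Γ.measurable_st a m).aemeasurable (f := fun k => Γ.g k (a m))
    hm.aestronglyMeasurable
  rw [← h, Γ.map_st m hp a]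
  unfold vecMeasure
  rw [integral_finsetSum_measure]
  · refine Finset.sum_congr rfl fun k _ => ?_
    rw [integral_smul_measure, integral_dirac, ENNReal.toReal_ofReal ((Γ.bel_belief m hp a).1 k),
      smul_eq_mul]
  · intro k _
    exact (integrable_dirac (by simp)).smul_measure ENNReal.ofReal_ne_top

/-- Fatou. -/
lemma pa_le_of_eventually {p : Γ.K → ℝ} (hp : IsBelief p) (a : ℕ → Γ.A) (c : ℝ)
    (h : ∀ᶠ n : ℕ in atTop, (1 / n : ℝ) * ∑ m ∈ Finset.range n, ∑ k, Γ.bel p a m k * Γ.g k (a m) ≤ c) :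
    Γ.pa p a ≤ c := by
  have := Γ.PP_prob hp
  have hE : ∀ n : ℕ, ∫ y, Γ.av a y n ∂(Γ.PP p)
      = (1 / n : ℝ) * ∑ m ∈ Finset.range n, ∑ k, Γ.bel p a m k * Γ.g k (a m) := by
    intro n
    unfold av
    rw [integral_const_mul, integral_finsetSum]
    · simp_rw [Γ.integral_av _ hp]
    · intro m _
      exact integrable_of_abs_le ((measurable_of_finite fun k => Γ.g k (a m)).comp (Γ.measurable_st a m)) 1
        fun y => Γ.abs_g _ _
  let I : ℕ → Γ.K × (ℕ → ℝ) → ℝ := fun n y => ⨅ i, Γ.av a y (i + n)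
  have hbd : ∀ y n, BddBelow (Set.range fun i => Γ.av a y (i + n)) := fun y n =>
    ⟨-1, by rintro _ ⟨i, rfl⟩; exact (abs_le.1 (Γ.abs_av a y _)).1⟩
  have hIm : ∀ n, Measurable (I n) := fun n => Measurable.iInf fun i => Γ.measurable_av a _
  have hIle : ∀ n y, I n y ≤ Γ.av a y n := fun n y => by
    have := ciInf_le (hbd y n) 0
    simpa using this
  have hIb : ∀ n y, |I n y| ≤ 1 := fun n y => abs_le.2
    ⟨le_ciInf fun i => (abs_le.1 (Γ.abs_av a y _)).1, (hIle n y).trans (abs_le.1 (Γ.abs_av a y _)).2⟩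
  have hIt : ∀ y, Tendsto (fun n => I n y) atTop (nhds (Γ.LL a y)) := by
    intro y
    rw [tendsto_order]
    have bu : IsBoundedUnder (· ≥ ·) atTop (Γ.av a y) :=
      isBoundedUnder_of ⟨-1, fun n => (abs_le.1 (Γ.abs_av a y n)).1⟩
    have cu : IsCoboundedUnder (· ≥ ·) atTop (Γ.av a y) :=
      (isBoundedUnder_of ⟨1, fun n => (abs_le.1 (Γ.abs_av a y n)).2⟩ :
        IsBoundedUnder (· ≤ ·) atTop (Γ.av a y)).isCoboundedUnder_ge
    constructor
    · intro d hd
      obtain ⟨e, he1, he2⟩ := exists_between hd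
      obtain ⟨N, hN⟩ := eventually_atTop.1 (eventually_lt_of_lt_liminf he2 bu)
      filter_upwards [eventually_ge_atTop N] with n hn
      exact he1.trans_le (le_ciInf fun i => (hN _ (by omega)).le)
    · intro d hd
      refine Eventually.of_forall fun n => lt_of_le_of_lt ?_ hd
      apply le_liminf_of_le cu
      filter_upwards [eventually_ge_atTop n] with i hi
      have := ciInf_le (hbd y n) (i - n)
      simpa [Nat.sub_add_cancel hi] using this
  have hlim : Tendsto (fun n => ∫ y, I n y ∂(Γ.PP p)) atTop (nhds (Γ.pa p a)) := by
    apply tendsto_integral_of_dominated_convergence (fun _ => 1)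
    · exact fun n => (hIm n).aestronglyMeasurable
    · exact integrable_const _
    · exact fun n => Eventually.of_forall (hIb n)
    · exact Eventually.of_forall hIt
  refine le_of_tendsto hlim ?_
  filter_upwards [h] with n hn
  rw [← hE] at hn
  refine le_trans (integral_mono ?_ ?_ (hIle n)) hn
  · exact integrable_of_abs_le (hIm n) 1 (hIb n)
  · exact integrable_of_abs_le (Γ.measurable_av a n) 1 (fun y => Γ.abs_av a y n)

end POMDP
end Part4

section Part5
section KB
set_option linter.unusedSectionVars false
variable {E : Type*} [MeasurableSpace E] [TopologicalSpace E] [T2Space E] [BorelSpace E]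
  [CompactSpace E]

noncomputable def emp (T : E → E) (x : E) (n : ℕ) : Measure E :=
  (n : ENNReal)⁻¹ • ∑ m ∈ Finset.range n, Measure.dirac (T^[m] x)

lemma emp_prob (T : E → E) (x : E) {n : ℕ} (hn : 0 < n) : IsProbabilityMeasure (emp T x n) := by
  constructor
  simp only [emp, Measure.smul_apply, Measure.coe_finsetSum, Finset.sum_apply, measure_univ,
    Finset.sum_const, Finset.card_range, smul_eq_mul, nsmul_eq_mul, mul_one]
  exact ENNReal.inv_mul_cancel (by exact_mod_cast hn.ne') (ENNReal.natCast_ne_top n)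

lemma integral_emp (T : E → E) (x : E) (n : ℕ) {F : E → ℝ} (hF : Continuous F) :
    ∫ y, F y ∂(emp T x n) = bavg T F x n := by
  unfold emp bavg
  rw [integral_smul_measure, integral_finsetSum_measure]
  · simp_rw [integral_dirac' _ _ hF.stronglyMeasurable]
    simp
  · intro m _
    exact integrable_dirac' hF.stronglyMeasurable (by simp)

lemma bavg_diff (T : E → E) (x : E) (n : ℕ) (F : E → ℝ) (C : ℝ) (hC : ∀ y, |F y| ≤ C) :
    |bavg T (fun y => F (T y)) x n - bavg T F x n| ≤ 2 * C / n := by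
  unfold bavg
  rw [← mul_sub, ← Finset.sum_sub_distrib]
  have : ∀ m, F (T (T^[m] x)) - F (T^[m] x) = F (T^[m+1] x) - F (T^[m] x) := fun m => by
    rw [Function.iterate_succ_apply']
  simp_rw [this]
  rw [Finset.sum_range_sub (fun m => F (T^[m] x)), abs_mul, abs_of_nonneg (by positivity)]
  have h1 := abs_le.1 (hC (T^[n] x))
  have h2 := abs_le.1 (hC (T^[0] x))
  have : |F (T^[n] x) - F (T^[0] x)| ≤ 2 * C := abs_le.2 ⟨by linarith, by linarith⟩
  calc (1 / n : ℝ) * _ ≤ (1 / n : ℝ) * (2 * C) := by gcongr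
    _ = _ := by ring

lemma krylov [TopologicalSpace.PseudoMetrizableSpace E] {T : E → E} (hT : Continuous T) {f d : E → ℝ}
    (hf : Continuous f) (hd : Continuous d) (hd0 : ∀ x, 0 ≤ d x) (w : ℝ)
    (h : ∀ j : ℕ, ∃ x, ∃ n ≥ j + 1, (∀ m, d (T^[m] x) = 0) ∧ w - 1 / (j + 1) ≤ bavg T f x n) :
    ∃ μ : Measure E, IsProbabilityMeasure μ ∧ MeasurePreserving T μ μ ∧ w ≤ ∫ x, f x ∂μ ∧
      ∀ᵐ x ∂μ, d x = 0 := by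
  choose x n hn hdx hw using h
  let ν : ℕ → ProbabilityMeasure E := fun j => ⟨emp T (x j) (n j), emp_prob T _ (by have := hn j; omega)⟩
  let U : Ultrafilter ℕ := Ultrafilter.of atTop
  have hU : (U : Filter ℕ) ≤ atTop := Ultrafilter.of_le atTop
  obtain ⟨μ, -, hμ⟩ := isCompact_univ.ultrafilter_le_nhds (U.map ν) (by simp)
  have hlim : Tendsto ν U (nhds μ) := hμ
  rw [ProbabilityMeasure.tendsto_iff_forall_integral_tendsto] at hlim
  have key : ∀ F : E → ℝ, Continuous F → Tendsto (fun j => bavg T F (x j) (n j)) U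
      (nhds (∫ y, F y ∂(μ : Measure E))) := by
    intro F hF
    have := hlim (BoundedContinuousFunction.mkOfCompact ⟨F, hF⟩)
    simp only [BoundedContinuousFunction.mkOfCompact_apply, ContinuousMap.coe_mk] at this
    refine this.congr fun j => ?_
    exact integral_emp T (x j) (n j) hF
  have hinv : (μ : Measure E).map T = μ := by
    have : IsProbabilityMeasure ((μ : Measure E).map T) :=
      Measure.isProbabilityMeasure_map hT.measurable.aemeasurable
    apply ext_of_forall_integral_eq_of_IsFiniteMeasure
    intro F
    rw [integral_map hT.measurable.aemeasurable F.continuous.aestronglyMeasurable]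
    have h1 := key _ (F.continuous.comp hT)
    have h2 := key _ F.continuous
    have h3 := h1.sub h2
    have h4 : Tendsto (fun j : ℕ => 2 * ‖F‖ / (j + 1 : ℝ)) U (nhds 0) := by
      refine Tendsto.mono_left ?_ hU
      have := (tendsto_one_div_add_atTop_nhds_zero_nat (𝕜 := ℝ)).const_mul (2 * ‖F‖)
      simpa [div_eq_mul_inv] using this
    refine sub_eq_zero.1 (tendsto_nhds_unique h3 (squeeze_zero_norm (fun j => ?_) h4))
    · refine (bavg_diff T (x j) (n j) F ‖F‖ fun y => F.norm_coe_le_norm y).trans ?_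
      have : (j + 1 : ℝ) ≤ n j := by exact_mod_cast hn j
      gcongr
  refine ⟨μ, inferInstance, ⟨hT.measurable, hinv⟩, ?_, ?_⟩
  · have h4 : Tendsto (fun j : ℕ => w - 1 / (j + 1 : ℝ)) U (nhds (w - 0)) :=
      (tendsto_one_div_add_atTop_nhds_zero_nat.mono_left hU).const_sub w
    rw [sub_zero] at h4
    exact le_of_tendsto_of_tendsto' h4 (key f hf) hw
  · have h1 := key d hd
    have h2 : ∀ j, bavg T d (x j) (n j) = 0 := fun j => by simp [bavg, hdx]
    simp_rw [h2] at h1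
    have h3 := tendsto_nhds_unique h1 tendsto_const_nhds
    rw [integral_eq_zero_iff_of_nonneg hd0] at h3
    · exact h3
    · obtain ⟨C, hC⟩ := isCompact_univ.exists_bound_of_continuousOn hd.continuousOn
      exact Integrable.of_bound hd.aestronglyMeasurable C
        (Eventually.of_forall fun x => hC x (Set.mem_univ x))
end KB
end Part5

section Part6
namespace POMDP
variable (Γ : POMDP)

/-- conditional expectation of the limit given the state -/
noncomputable def hh (a : ℕ → Γ.A) (k : Γ.K) : ℝ := ∫ u, Γ.LL a (k, u) ∂lamU

lemma st_splice (a : ℕ → Γ.A) (k : Γ.K) (N : ℕ) (u v : ℕ → ℝ) (m : ℕ) (hm : m ≤ N) :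
    Γ.st a (k, splice N (u, v)) m = Γ.st a (k, u) m := by
  induction m with
  | zero => rfl
  | succ m ih =>
    rw [st_succ, st_succ, ih (by omega)]
    simp [splice, show m < N by omega]

lemma av_splice (a : ℕ → Γ.A) (k : Γ.K) (N : ℕ) (u v : ℕ → ℝ) :
    Γ.av a (k, splice N (u, v)) N = Γ.av a (k, u) N := by
  unfold av
  congr 1
  refine Finset.sum_congr rfl fun m hm => ?_
  rw [Γ.st_splice a k N u v m (Finset.mem_range.1 hm).le]

lemma st_add (a : ℕ → Γ.A) (y : Γ.K × (ℕ → ℝ)) (N m : ℕ) :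
    Γ.st (fun i => a (i + N)) (Γ.st a y N, fun i => y.2 (i + N)) m = Γ.st a y (m + N) := by
  induction m with
  | zero => simp [st]
  | succ m ih =>
    rw [st_succ, ih, show m + 1 + N = (m + N) + 1 by omega, st_succ]

lemma LL_shift (N : ℕ) : ∀ (a : ℕ → Γ.A) (y : Γ.K × (ℕ → ℝ)),
    Γ.LL (fun i => a (i + N)) (Γ.st a y N, fun i => y.2 (i + N)) = Γ.LL a y := by
  induction N with
  | zero => intro a y; rfl
  | succ N ih =>
    intro a y
    rw [← Γ.LL_step a y, ← ih (fun i => a (i+1)) (Γ.step (a 0) y), ← Γ.st_step]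
    rfl

lemma LL_splice (a : ℕ → Γ.A) (k : Γ.K) (N : ℕ) (u v : ℕ → ℝ) :
    Γ.LL a (k, splice N (u, v)) = Γ.LL (fun i => a (i + N)) (Γ.st a (k, u) N, v) := by
  rw [← Γ.LL_shift N a, Γ.st_splice a k N u v N le_rfl]
  congr 2
  funext i
  simp [splice]

lemma point_bound (a : ℕ → Γ.A) (k : Γ.K) (N : ℕ) :
    ∫⁻ u, ‖Γ.av a (k, u) N - Γ.hh (fun i => a (i + N)) (Γ.st a (k, u) N)‖ₑ ∂lamU ≤
      ∫⁻ u, ‖Γ.av a (k, u) N - Γ.LL a (k, u)‖ₑ ∂lamU := by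
  have hD : Measurable fun v : ℕ → ℝ => Γ.av a (k, v) N - Γ.LL a (k, v) :=
    ((Γ.measurable_av a N).comp measurable_prodMk_left).sub
      ((Γ.measurable_LL a).comp measurable_prodMk_left)
  have hG : Measurable fun v : ℕ → ℝ => ‖Γ.av a (k, v) N - Γ.LL a (k, v)‖ₑ := hD.enorm
  conv_rhs => rw [← map_splice N]
  rw [lintegral_map hG (measurable_splice N),
    lintegral_prod (fun w => ‖Γ.av a (k, splice N w) N - Γ.LL a (k, splice N w)‖ₑ)
      (Measurable.comp hG (measurable_splice N)).aemeasurable]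
  refine lintegral_mono fun u => ?_
  have hi : Integrable (fun v => Γ.LL (fun i => a (i + N)) (Γ.st a (k, u) N, v)) lamU :=
    integrable_of_abs_le ((Γ.measurable_LL _).comp measurable_prodMk_left) 1 fun v => Γ.abs_LL _ _
  have : Γ.av a (k, u) N - Γ.hh (fun i => a (i + N)) (Γ.st a (k, u) N)
      = ∫ v, (Γ.av a (k, splice N (u, v)) N - Γ.LL a (k, splice N (u, v))) ∂lamU := by
    simp_rw [Γ.av_splice, Γ.LL_splice]
    rw [integral_sub (integrable_const _) hi]
    simp [hh]
  rw [this]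
  exact enorm_integral_le_lintegral_enorm _

lemma lintegral_PP (p : Γ.K → ℝ) {F : Γ.K × (ℕ → ℝ) → ENNReal} (hF : Measurable F) :
    ∫⁻ y, F y ∂(Γ.PP p) = ∑ k, ENNReal.ofReal (p k) * ∫⁻ u, F (k, u) ∂lamU := by
  rw [PP, lintegral_prod _ hF.aemeasurable, vecMeasure, lintegral_finsetSum_measure]
  refine Finset.sum_congr rfl fun k _ => ?_
  rw [lintegral_smul_measure, lintegral_dirac, smul_eq_mul]

lemma PP_bound (p : Γ.K → ℝ) (a : ℕ → Γ.A) (N : ℕ) :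
    ∫⁻ y, ‖Γ.av a y N - Γ.hh (fun i => a (i + N)) (Γ.st a y N)‖ₑ ∂(Γ.PP p) ≤
      ∫⁻ y, ‖Γ.av a y N - Γ.LL a y‖ₑ ∂(Γ.PP p) := by
  have h1 : Measurable fun y => ‖Γ.av a y N - Γ.LL a y‖ₑ :=
    ((Γ.measurable_av a N).sub (Γ.measurable_LL a)).enorm
  have h2 : Measurable fun y => ‖Γ.av a y N - Γ.hh (fun i => a (i + N)) (Γ.st a y N)‖ₑ :=
    ((Γ.measurable_av a N).sub
      ((measurable_of_finite (Γ.hh (fun i => a (i + N)))).comp (Γ.measurable_st a N))).enorm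
  rw [Γ.lintegral_PP p h1, Γ.lintegral_PP p h2]
  exact Finset.sum_le_sum fun k _ => mul_le_mul_right (Γ.point_bound a k N) _

/-! the dynamical system -/

abbrev XX := (stdSimplex ℝ Γ.K) × (ℕ → Γ.A)
abbrev YY := Γ.K × (ℕ → ℝ)

lemma bX (x : Γ.XX) : IsBelief x.1.1 := ⟨x.1.2.1, x.1.2.2⟩

def TX (x : Γ.XX) : Γ.XX :=
  (⟨Γ.upd x.1.1 (x.2 0), ⟨(Γ.upd_belief (Γ.bX x) _).1, (Γ.upd_belief (Γ.bX x) _).2⟩⟩,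
    fun i => x.2 (i + 1))

lemma continuous_TX : Continuous Γ.TX := by
  unfold TX
  refine Continuous.prodMk (Continuous.subtype_mk (continuous_pi fun k' => ?_) _)
    (continuous_pi fun i => (continuous_apply (i+1)).comp continuous_snd)
  unfold upd
  refine continuous_finsetSum _ fun k _ => ?_
  refine ((continuous_apply k).comp (continuous_subtype_val.comp continuous_fst)).mul ?_
  exact (continuous_of_discreteTopology (f := fun a => Γ.Q k a k')).comp
    ((continuous_apply 0).comp continuous_snd)

lemma TX_iter (m : ℕ) : ∀ x : Γ.XX, ((Γ.TX^[m]) x).1.1 = Γ.bel x.1.1 x.2 m ∧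
    ((Γ.TX^[m]) x).2 = fun i => x.2 (i + m) := by
  induction m with
  | zero => intro x; exact ⟨rfl, rfl⟩
  | succ m ih =>
    intro x
    rw [Function.iterate_succ_apply]
    refine ⟨(ih (Γ.TX x)).1, (ih (Γ.TX x)).2⟩

noncomputable def fX (x : Γ.XX) : ℝ := ∑ k, x.1.1 k * Γ.g k (x.2 0)

lemma continuous_fX : Continuous Γ.fX := by
  unfold fX
  refine continuous_finsetSum _ fun k _ => ?_
  refine ((continuous_apply k).comp (continuous_subtype_val.comp continuous_fst)).mul ?_
  exact (continuous_of_discreteTopology (f := fun a => Γ.g k a)).comp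
    ((continuous_apply 0).comp continuous_snd)

def reach (p : Γ.K → ℝ) : Set (Γ.K → ℝ) := Set.range fun z : (ℕ → Γ.A) × ℕ => Γ.bel p z.1 z.2

lemma exists_inv (hΓ : Γ.Blind) {p1 : Γ.K → ℝ} (hp1 : IsBelief p1) :
    ∃ μ : Measure Γ.XX, IsProbabilityMeasure μ ∧ MeasurePreserving Γ.TX μ μ ∧
      Γ.val p1 ≤ ∫ x, Γ.fX x ∂μ ∧ ∀ᵐ x ∂μ, x.1.1 ∈ closure (Γ.reach p1) := by
  have hne : (Γ.reach p1).Nonempty := ⟨_, ⟨(fun _ => ⟨0, Γ.hA⟩, 0), rfl⟩⟩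
  have main : ∀ j : ℕ, ∃ x : Γ.XX, ∃ n ≥ j + 1,
      (∀ m, Metric.infDist ((Γ.TX^[m]) x).1.1 (Γ.reach p1) = 0) ∧
        Γ.val p1 - 1 / (j + 1) ≤ bavg Γ.TX Γ.fX x n := by
    intro j
    have hpos : (0:ℝ) < 1 / (j + 1) := by positivity
    have : ∃ a, Γ.val p1 - 1 / (j + 1) / 2 < Γ.pa p1 a := by
      by_contra hcon
      push Not at hcon
      have := Γ.val_le hΓ _ hcon
      linarith
    obtain ⟨a, ha⟩ := this
    have hfr : ∃ᶠ n : ℕ in atTop, Γ.val p1 - 1 / (j + 1) <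
        (1 / n : ℝ) * ∑ m ∈ Finset.range n, ∑ k, Γ.bel p1 a m k * Γ.g k (a m) := by
      intro hcon
      have := Γ.pa_le_of_eventually hp1 a (Γ.val p1 - 1 / (j + 1))
        (hcon.mono fun n hn => not_lt.1 hn)
      linarith
    obtain ⟨n, hn, hn'⟩ := frequently_atTop.1 hfr (j+1)
    let x : Γ.XX := (⟨p1, ⟨hp1.1, hp1.2⟩⟩, a)
    refine ⟨x, n, hn, fun m => ?_, ?_⟩
    · rw [(Γ.TX_iter m x).1]
      exact Metric.infDist_zero_of_mem ⟨(a, m), rfl⟩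
    · refine hn'.le.trans (le_of_eq ?_)
      unfold bavg
      congr 1
      refine Finset.sum_congr rfl fun m _ => ?_
      unfold fX
      rw [(Γ.TX_iter m x).1, (Γ.TX_iter m x).2]
      simp [x]
  obtain ⟨μ, h1, h2, h3, h4⟩ := krylov (E := Γ.XX) Γ.continuous_TX (f := Γ.fX)
    (d := fun x => Metric.infDist x.1.1 (Γ.reach p1)) Γ.continuous_fX
    ((Metric.continuous_infDist_pt _).comp (continuous_subtype_val.comp continuous_fst))
    (fun x => Metric.infDist_nonneg) (Γ.val p1) main
  · refine ⟨μ, h1, h2, h3, ?_⟩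
    filter_upwards [h4] with x hx
    exact (Metric.mem_closure_iff_infDist_zero hne).2 hx

noncomputable def kap : Kernel Γ.XX Γ.YY where
  toFun x := Γ.PP x.1.1
  measurable' := by
    refine Measure.measurable_of_measurable_coe _ fun s hs => ?_
    simp_rw [Γ.PP_apply _ hs]
    refine Finset.measurable_sum _ fun k _ => ?_
    refine Measurable.mul_const (ENNReal.measurable_ofReal.comp ?_) _
    exact (measurable_pi_apply k).comp (measurable_subtype_coe.comp measurable_fst)

lemma kap_apply (x : Γ.XX) : Γ.kap x = Γ.PP x.1.1 := rfl

instance : IsMarkovKernel Γ.kap := ⟨fun x => Γ.PP_prob (Γ.bX x)⟩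

noncomputable def TT (z : Γ.XX × Γ.YY) : Γ.XX × Γ.YY := (Γ.TX z.1, Γ.step (z.1.2 0) z.2)

lemma meas_pair {X Y Z W : Type*} [MeasurableSpace X] [MeasurableSpace Y] [MeasurableSpace W]
    [MeasurableSpace Z] {F : Y → W → Z} (hF : Measurable fun z : Y × W => F z.1 z.2)
    {k : X → Y} {u : X → W}
    (hk : Measurable k) (hu : Measurable u) : Measurable fun x => F (k x) (u x) :=
  hF.comp (hk.prodMk hu)

lemma measurable_TT : Measurable Γ.TT := by
  unfold TT
  refine (Γ.continuous_TX.measurable.comp measurable_fst).prodMk ?_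
  exact meas_pair (F := Γ.step) Γ.measurable_step'
    ((measurable_pi_apply 0).comp (measurable_snd.comp measurable_fst)) measurable_snd

lemma preserving_TT (μ : Measure Γ.XX) [IsProbabilityMeasure μ] (hμ : MeasurePreserving Γ.TX μ μ) :
    MeasurePreserving Γ.TT (μ ⊗ₘ Γ.kap) (μ ⊗ₘ Γ.kap) := by
  refine ⟨Γ.measurable_TT, ?_⟩
  ext s hs
  rw [Measure.map_apply Γ.measurable_TT hs, Measure.compProd_apply (Γ.measurable_TT hs),
    Measure.compProd_apply hs,
    ← hμ.lintegral_comp (Kernel.measurable_kernel_prodMk_left hs)]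
  refine lintegral_congr fun x => ?_
  rw [Γ.kap_apply, Γ.kap_apply]
  change _ = Γ.PP (Γ.upd x.1.1 (x.2 0)) _
  rw [← Γ.map_step (Γ.bX x), Measure.map_apply (Γ.measurable_step _) (measurable_prodMk_left hs)]
  rfl

lemma TT_iter (m : ℕ) : ∀ z : Γ.XX × Γ.YY, (Γ.TT^[m]) z =
    ((Γ.TX^[m]) z.1, (Γ.st z.1.2 z.2 m, fun i => z.2.2 (i + m))) := by
  induction m with
  | zero => intro z; rfl
  | succ m ih =>
    intro z
    rw [Function.iterate_succ_apply, ih, Function.iterate_succ_apply, Γ.st_step]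
    rfl

noncomputable def fT (z : Γ.XX × Γ.YY) : ℝ := Γ.g z.2.1 (z.1.2 0)

lemma measurable_fT : Measurable Γ.fT := by
  have h : Measurable fun z : Γ.XX × Γ.YY => (z.2.1, z.1.2 0) :=
    (measurable_fst.comp measurable_snd).prodMk
      ((measurable_pi_apply 0).comp (measurable_snd.comp measurable_fst))
  exact Measurable.comp (g := fun z : Γ.K × Γ.A => Γ.g z.1 z.2) (measurable_of_finite _) h

lemma bavg_TT (z : Γ.XX × Γ.YY) : bavg Γ.TT Γ.fT z = Γ.av z.1.2 z.2 := by
  funext n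
  unfold bavg av
  congr 1
  refine Finset.sum_congr rfl fun m _ => ?_
  unfold fT
  rw [Γ.TT_iter, (Γ.TX_iter m z.1).2]
  simp

end POMDP
end Part6

section Part7
namespace POMDP
variable (Γ : POMDP)

lemma measurable_av2 (n : ℕ) : Measurable fun z : Γ.XX × Γ.YY => Γ.av z.1.2 z.2 n := by
  have := measurable_bavg Γ.measurable_TT Γ.measurable_fT n
  simpa only [Γ.bavg_TT] using this

lemma measurable_LL2 : Measurable fun z : Γ.XX × Γ.YY => Γ.LL z.1.2 z.2 :=
  Measurable.liminf fun n => Γ.measurable_av2 n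

lemma measurable_hh2 : Measurable fun z : Γ.XX × Γ.YY => Γ.hh z.1.2 z.2.1 := by
  have h1 : Measurable fun w : (Γ.XX × Γ.K) × (ℕ → ℝ) => Γ.LL w.1.1.2 (w.1.2, w.2) :=
    meas_pair (F := fun (x : Γ.XX) (y : Γ.YY) => Γ.LL x.2 y) Γ.measurable_LL2
      (measurable_fst.comp measurable_fst)
      ((measurable_snd.comp measurable_fst).prodMk measurable_snd)
  have h2 : Measurable fun w : Γ.XX × Γ.K => Γ.hh w.1.2 w.2 :=
    (h1.stronglyMeasurable.integral_prod_right (ν := lamU)).measurable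
  exact meas_pair (F := fun (x : Γ.XX) (k : Γ.K) => Γ.hh x.2 k) h2 measurable_fst
    (measurable_fst.comp measurable_snd)

lemma L1_conv (μ : Measure Γ.XX) [IsProbabilityMeasure μ]
    (hB1 : ∀ᵐ z ∂(μ ⊗ₘ Γ.kap), Tendsto (Γ.av z.1.2 z.2) atTop (nhds (Γ.LL z.1.2 z.2))) :
    Tendsto (fun N => ∫⁻ z, ‖Γ.av z.1.2 z.2 N - Γ.LL z.1.2 z.2‖ₑ ∂(μ ⊗ₘ Γ.kap)) atTop (nhds 0) := by
  set M := μ ⊗ₘ Γ.kap with hM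
  -- L1 convergence
  have hL1 : Tendsto (fun N => ∫⁻ z, ‖Γ.av z.1.2 z.2 N - Γ.LL z.1.2 z.2‖ₑ ∂M) atTop (nhds 0) := by
    have h0 : (0 : ENNReal) = ∫⁻ _z : Γ.XX × Γ.YY, 0 ∂M := by simp
    rw [h0]
    refine tendsto_lintegral_of_dominated_convergence (fun _ => ENNReal.ofReal 2)
      (fun N => ((Γ.measurable_av2 N).sub Γ.measurable_LL2).enorm) ?_ ?_ ?_
    · intro N
      refine Eventually.of_forall fun z => ?_
      change ‖_‖ₑ ≤ ENNReal.ofReal 2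
      rw [← ofReal_norm]
      apply ENNReal.ofReal_le_ofReal
      refine (norm_sub_le _ _).trans ?_
      have h1 : ‖Γ.av z.1.2 z.2 N‖ ≤ 1 := Γ.abs_av _ _ _
      have h2 : ‖Γ.LL z.1.2 z.2‖ ≤ 1 := Γ.abs_LL _ _
      linarith
    · simp
    · filter_upwards [hB1] with z hz
      have h1 := (hz.sub_const (Γ.LL z.1.2 z.2)).enorm
      simpa using h1
  exact hL1

lemma measurable_hhN (N : ℕ) : Measurable fun z : Γ.XX × Γ.YY =>
        Γ.hh (fun i => z.1.2 (i + N)) (Γ.st z.1.2 z.2 N) := by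
      have h := Γ.measurable_hh2.comp (Γ.measurable_TT.iterate N)
      have e : (fun z : Γ.XX × Γ.YY => Γ.hh (fun i => z.1.2 (i + N)) (Γ.st z.1.2 z.2 N)) =
          (fun z : Γ.XX × Γ.YY => Γ.hh z.1.2 z.2.1) ∘ (Γ.TT^[N]) := by
        funext z
        rw [Function.comp_apply, Γ.TT_iter, (Γ.TX_iter N z.1).2]
      rw [e]
      exact h

lemma const_bound (μ : Measure Γ.XX) [IsProbabilityMeasure μ] (hinv : MeasurePreserving Γ.TX μ μ) (N : ℕ) :
    ∫⁻ z, ‖Γ.LL z.1.2 z.2 - Γ.hh z.1.2 z.2.1‖ₑ ∂(μ ⊗ₘ Γ.kap) ≤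
      ∫⁻ z, ‖Γ.av z.1.2 z.2 N - Γ.LL z.1.2 z.2‖ₑ ∂(μ ⊗ₘ Γ.kap) +
      ∫⁻ z, ‖Γ.av z.1.2 z.2 N - Γ.LL z.1.2 z.2‖ₑ ∂(μ ⊗ₘ Γ.kap) := by
    set M := μ ⊗ₘ Γ.kap with hM
    have hTT : MeasurePreserving Γ.TT M M := Γ.preserving_TT μ hinv
    have hm : Measurable fun z : Γ.XX × Γ.YY => ‖Γ.LL z.1.2 z.2 - Γ.hh z.1.2 z.2.1‖ₑ :=
      (Γ.measurable_LL2.sub Γ.measurable_hh2).enorm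
    have hTN : ∀ z : Γ.XX × Γ.YY, ‖Γ.LL ((Γ.TT^[N]) z).1.2 ((Γ.TT^[N]) z).2
        - Γ.hh ((Γ.TT^[N]) z).1.2 ((Γ.TT^[N]) z).2.1‖ₑ =
        ‖Γ.LL z.1.2 z.2 - Γ.hh (fun i => z.1.2 (i + N)) (Γ.st z.1.2 z.2 N)‖ₑ := by
      intro z
      rw [Γ.TT_iter, (Γ.TX_iter N z.1).2, Γ.LL_shift]
    have hm1 : Measurable fun z : Γ.XX × Γ.YY => ‖Γ.av z.1.2 z.2 N - Γ.LL z.1.2 z.2‖ₑ :=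
      ((Γ.measurable_av2 N).sub Γ.measurable_LL2).enorm
    have hm2 : Measurable fun z : Γ.XX × Γ.YY =>
        ‖Γ.av z.1.2 z.2 N - Γ.hh (fun i => z.1.2 (i + N)) (Γ.st z.1.2 z.2 N)‖ₑ :=
      ((Γ.measurable_av2 N).sub (Γ.measurable_hhN N)).enorm
    rw [← (hTT.iterate N).lintegral_comp hm]
    simp_rw [hTN]
    calc _ ≤ ∫⁻ z, (‖Γ.av z.1.2 z.2 N - Γ.LL z.1.2 z.2‖ₑ +
          ‖Γ.av z.1.2 z.2 N - Γ.hh (fun i => z.1.2 (i + N)) (Γ.st z.1.2 z.2 N)‖ₑ) ∂M := by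
          refine lintegral_mono fun z => ?_
          have : Γ.LL z.1.2 z.2 - Γ.hh (fun i => z.1.2 (i + N)) (Γ.st z.1.2 z.2 N)
            = -(Γ.av z.1.2 z.2 N - Γ.LL z.1.2 z.2) +
              (Γ.av z.1.2 z.2 N - Γ.hh (fun i => z.1.2 (i + N)) (Γ.st z.1.2 z.2 N)) := by ring
          rw [this]
          refine (enorm_add_le _ _).trans ?_
          rw [enorm_neg]
      _ = _ + ∫⁻ z, ‖Γ.av z.1.2 z.2 N - Γ.hh (fun i => z.1.2 (i + N)) (Γ.st z.1.2 z.2 N)‖ₑ ∂M :=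
          lintegral_add_left hm1 _
      _ ≤ _ := by
          refine add_le_add le_rfl ?_
          rw [hM, Measure.lintegral_compProd hm2, Measure.lintegral_compProd hm1]
          exact lintegral_mono fun x => Γ.PP_bound x.1.1 x.2 N

lemma integral_fT (x : Γ.XX) : ∫ y, Γ.fT (x, y) ∂(Γ.PP x.1.1) = Γ.fX x := by
  have hm : Measurable fun y : Γ.YY => Γ.g y.1 (x.2 0) :=
    Measurable.comp (g := fun k => Γ.g k (x.2 0)) (measurable_of_finite _) measurable_fst
  have := Γ.integral_PP (Γ.bX x).1 hm 1 (fun y => Γ.abs_g _ _)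
  unfold fT fX
  rw [this]
  simp

lemma abs_fT (z : Γ.XX × Γ.YY) : |Γ.fT z| ≤ 1 := Γ.abs_g _ _

lemma int_LL2 (μ : Measure Γ.XX) [IsProbabilityMeasure μ] :
    Integrable (fun z : Γ.XX × Γ.YY => Γ.LL z.1.2 z.2) (μ ⊗ₘ Γ.kap) :=
  integrable_of_abs_le Γ.measurable_LL2 1 fun z => Γ.abs_LL z.1.2 z.2

lemma int_fT (μ : Measure Γ.XX) [IsProbabilityMeasure μ] :
    Integrable Γ.fT (μ ⊗ₘ Γ.kap) :=
  integrable_of_abs_le Γ.measurable_fT 1 Γ.abs_fT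

lemma integral_pa (μ : Measure Γ.XX) [IsProbabilityMeasure μ]
    (hB2 : ∫ z, Γ.LL z.1.2 z.2 ∂(μ ⊗ₘ Γ.kap) = ∫ z, Γ.fT z ∂(μ ⊗ₘ Γ.kap)) :
    ∫ x, Γ.pa x.1.1 x.2 ∂μ = ∫ x, Γ.fX x ∂μ := by
  have e1 := Measure.integral_compProd (κ := Γ.kap) (Γ.int_LL2 μ)
  have e2 := Measure.integral_compProd (κ := Γ.kap) (Γ.int_fT μ)
  rw [hB2, e2] at e1
  refine e1.symm.trans (integral_congr_ae (Eventually.of_forall fun x => ?_))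
  exact Γ.integral_fT x

lemma int_pa (μ : Measure Γ.XX) [IsProbabilityMeasure μ] :
    Integrable (fun x : Γ.XX => Γ.pa x.1.1 x.2) μ := by
  have hm : Measurable fun x : Γ.XX => Γ.pa x.1.1 x.2 :=
    (StronglyMeasurable.integral_kernel_prod_right' (κ := Γ.kap)
      Γ.measurable_LL2.stronglyMeasurable).measurable
  refine integrable_of_abs_le hm 1 fun x => ?_
  have := Γ.PP_prob (Γ.bX x)
  have h := norm_integral_le_of_norm_le_const (μ := Γ.PP x.1.1) (f := Γ.LL x.2) (C := 1)
    (Eventually.of_forall fun y => Γ.abs_LL x.2 y)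
  simpa [pa] using h

lemma hh_ae (μ : Measure Γ.XX) [IsProbabilityMeasure μ] (hinv : MeasurePreserving Γ.TX μ μ)
    (hB1 : ∀ᵐ z ∂(μ ⊗ₘ Γ.kap), Tendsto (Γ.av z.1.2 z.2) atTop (nhds (Γ.LL z.1.2 z.2))) :
    ∀ᵐ z ∂(μ ⊗ₘ Γ.kap), Tendsto (Γ.av z.1.2 z.2) atTop (nhds (Γ.hh z.1.2 z.2.1)) := by
  set M := μ ⊗ₘ Γ.kap with hM
  have hm : Measurable fun z : Γ.XX × Γ.YY => ‖Γ.LL z.1.2 z.2 - Γ.hh z.1.2 z.2.1‖ₑ :=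
    (Γ.measurable_LL2.sub Γ.measurable_hh2).enorm
  have hL1 := Γ.L1_conv μ hB1
  have hbound := Γ.const_bound μ hinv
  have hzero : ∫⁻ z, ‖Γ.LL z.1.2 z.2 - Γ.hh z.1.2 z.2.1‖ₑ ∂M = 0 := by
    have h2 := hL1.add hL1
    rw [add_zero] at h2
    exact le_antisymm (ge_of_tendsto' h2 hbound) zero_le
  rw [lintegral_eq_zero_iff hm] at hzero
  filter_upwards [hB1, hzero] with z h1 h2
  have h3 : Γ.LL z.1.2 z.2 = Γ.hh z.1.2 z.2.1 := by
    have : ‖Γ.LL z.1.2 z.2 - Γ.hh z.1.2 z.2.1‖ₑ = 0 := h2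
    exact sub_eq_zero.1 (enorm_eq_zero.1 this)
  rwa [h3] at h1

lemma birk_TT (μ : Measure Γ.XX) [IsProbabilityMeasure μ] (hinv : MeasurePreserving Γ.TX μ μ) :
    (∀ᵐ z ∂(μ ⊗ₘ Γ.kap), Tendsto (Γ.av z.1.2 z.2) atTop (nhds (Γ.LL z.1.2 z.2))) ∧
    ∫ z, Γ.LL z.1.2 z.2 ∂(μ ⊗ₘ Γ.kap) = ∫ z, Γ.fT z ∂(μ ⊗ₘ Γ.kap) := by
  have h := birkhoff (Γ.preserving_TT μ hinv) Γ.measurable_fT Γ.abs_fT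
  simp only [Γ.bavg_TT] at h
  exact h

lemma ergodic_point (hΓ : Γ.Blind) {p1 : Γ.K → ℝ} (hp1 : IsBelief p1) :
    ∃ x : Γ.XX, x.1.1 ∈ closure (Γ.reach p1) ∧ Γ.val p1 ≤ Γ.pa x.1.1 x.2 ∧
      ∀ᵐ y ∂(Γ.PP x.1.1), Tendsto (Γ.av x.2 y) atTop (nhds (Γ.hh x.2 y.1)) := by
  obtain ⟨μ, hμ, hinv, hw, hcl⟩ := Γ.exists_inv hΓ hp1
  obtain ⟨hB1, hB2⟩ := Γ.birk_TT μ hinv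
  have hae2 := Measure.ae_ae_of_ae_compProd (Γ.hh_ae μ hinv hB1)
  have hI := Γ.integral_pa μ hB2
  have hpai := Γ.int_pa μ
  have hnull : μ {x | ¬ (x.1.1 ∈ closure (Γ.reach p1) ∧
      ∀ᵐ y ∂(Γ.PP x.1.1), Tendsto (Γ.av x.2 y) atTop (nhds (Γ.hh x.2 y.1)))} = 0 :=
    ae_iff.1 (hcl.and hae2)
  obtain ⟨x, hx, hx2⟩ := exists_notMem_null_integral_le hpai hnull
  have hx' := not_not.1 hx
  exact ⟨x, hx'.1, (hw.trans_eq hI.symm).trans hx2, hx'.2⟩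

lemma val_closure_le (hΓ : Γ.Blind) {p1 p : Γ.K → ℝ} (hp1 : IsBelief p1) (hp : IsBelief p)
    (h : p ∈ closure (Γ.reach p1)) : Γ.val p ≤ Γ.val p1 := by
  apply Γ.val_le hΓ
  intro b
  rw [Γ.pa_eq hp.1]
  have hc : IsClosed {q : Γ.K → ℝ | ∑ k, q k * ∫ u, Γ.LL b (k, u) ∂lamU ≤ Γ.val p1} := by
    refine isClosed_le ?_ continuous_const
    fun_prop
  refine closure_minimal ?_ hc h
  rintro _ ⟨⟨a, m⟩, rfl⟩
  have := Γ.pa_reach_le hΓ hp1 a b m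
  rwa [Γ.pa_eq (Γ.bel_belief m hp1 a).1] at this

lemma ae_state {p : Γ.K → ℝ} {P : Γ.YY → Prop} (h : ∀ᵐ y ∂(Γ.PP p), P y) (k : Γ.K)
    (hk : 0 < p k) : ∀ᵐ u ∂lamU, P (k, u) := by
  have h1 := Measure.ae_ae_of_ae_prod h
  by_contra hcon
  have h2 : vecMeasure p {k} = 0 := by
    refine measure_mono_null ?_ (ae_iff.1 h1)
    rintro _ rfl
    exact hcon
  rw [vecMeasure_singleton, ENNReal.ofReal_eq_zero] at h2
  linarith

lemma PP_dirac (k : Γ.K) : Γ.PP (diracBelief k) = lamU.map (Prod.mk k) := by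
  have : vecMeasure (diracBelief k) = Measure.dirac k := by
    unfold vecMeasure diracBelief
    rw [Finset.sum_eq_single k] <;> simp +contextual
  rw [PP, this, Measure.dirac_prod]

lemma payK_eq (k : Γ.K) (a : ℕ → Γ.A) : Γ.payK k (Γ.blindStrat a) = Γ.hh a k := by
  rw [payK, Γ.pay_blind, pa, Γ.PP_dirac, integral_map measurable_prodMk_left.aemeasurable
    (Γ.measurable_LL a).aestronglyMeasurable]
  rfl

lemma ae_dirac (k : Γ.K) {P : Γ.YY → Prop} (h : ∀ᵐ u ∂lamU, P (k, u)) :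
    ∀ᵐ ω ∂(Γ.envMeasure (diracBelief k)), P (Γ.seed ω) := by
  have h1 : ∀ᵐ y ∂(Γ.PP (diracBelief k)), P y := by
    rw [Γ.PP_dirac]
    exact (measurableEmbedding_prodMk_left k).ae_map_iff.2 h
  rw [← Γ.map_seed] at h1
  exact ae_of_ae_map Γ.measurable_seed.aemeasurable h1

end POMDP
end Part7

end Aux

/-- **Lemma 2.** In a blind MDP with initial belief `p₁` there is a deterministic belief
`p*` that can be approximately reached from `p₁`, and a strategy `σ` whose average rewards
converge a.s. from every state in the support of `p*`, with
`γ^{p*}_∞(σ) = v_∞(p*) = v_∞(p₁)`. -/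
theorem blind_ergodic_belief (Γ : POMDP) (hΓ : Γ.Blind) (p1 : Γ.K → ℝ)
    (hp1 : IsBelief p1) :
    ∃ pstar : Γ.K → ℝ, IsBelief pstar ∧
      (∀ ε : ℝ, 0 < ε → ∃ as : ℕ → Γ.A, ∃ m0 ≥ 1,
        ∑ k, |Γ.blindBelief p1 (Γ.blindStrat as) (m0 - 1) k - pstar k| ≤ ε) ∧
      (∃ as : ℕ → Γ.A,
        (∀ k, 0 < pstar k →
          ∀ᵐ ω ∂(Γ.envMeasure (diracBelief k)),
            Tendsto (Γ.avg (Γ.blindStrat as) ω) atTop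
              (nhds (Γ.payK k (Γ.blindStrat as)))) ∧
        Γ.pay pstar (Γ.blindStrat as) = Γ.val pstar ∧ Γ.val pstar = Γ.val p1) := by
  obtain ⟨x, hcl, hval, hae⟩ := Γ.ergodic_point hΓ hp1
  have hb := Γ.bX x
  have h1 := Γ.val_closure_le hΓ hp1 hb hcl
  have h2 := Γ.le_val hΓ hb x.2
  refine ⟨x.1.1, hb, ?_, x.2, ?_, ?_, ?_⟩
  · intro ε hε
    have hn : (0:ℝ) < Γ.nK := by exact_mod_cast Γ.hK
    obtain ⟨_, ⟨⟨a, m⟩, rfl⟩, hd⟩ := Metric.mem_closure_iff.1 hcl (ε / Γ.nK) (by positivity)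
    refine ⟨a, m + 1, by omega, ?_⟩
    rw [Nat.add_sub_cancel, Γ.blindBelief_eq hp1]
    calc ∑ k, |Γ.bel p1 a m k - x.1.1 k| ≤ ∑ _k : Γ.K, ε / Γ.nK := by
          refine Finset.sum_le_sum fun k _ => ?_
          rw [dist_comm] at hd
          have := (dist_le_pi_dist (Γ.bel p1 a m) x.1.1 k).trans hd.le
          rwa [Real.dist_eq] at this
      _ = ε := by
          simp only [Finset.sum_const, Finset.card_univ, Fintype.card_fin, nsmul_eq_mul]
          field_simp
  · intro k hk
    have h3 := Γ.ae_state hae k hk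
    rw [Γ.payK_eq]
    simp_rw [Γ.avg_blind]
    exact Γ.ae_dirac k (P := fun y => Tendsto (Γ.av x.2 y) atTop (nhds (Γ.hh x.2 k))) h3
  · rw [Γ.pay_blind]; linarith
  · linarith

end PomdpPaper
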